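/- arXiv:1608.04896 — 2 statements merged into one kernel-verified Lean document; each statement's English description precedes it below -/
import Mathlib

section
/- Uniqueness of the optimiser, isochoric case (Theorem of Section 5.2, second part): Let α < 0 and let Ω ⊂ ℝ² be a nonempty convex bounded open set with smooth boundary that is not a disk (i.e. Ω is not an open Euclidean ball). Let B_{R₂} ⊂ ℝ² be an open disk with |B_{R₂}| = |Ω| (equal 2-dimensional Lebesgue measure). Then the strict inequality λ₁^α(Ω^ext) < λ₁^α(B_{R₂}^ext) holds. -/
open MeasureTheory Metric Set Bornology Real Filter

noncomputable section

/-- The Euclidean plane. -/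
abbrev E2 := EuclideanSpace ℝ (Fin 2)

/-- The exterior of a set: complement of its closure. -/
def extDom (Ω : Set E2) : Set E2 := (closure Ω)ᶜ

/-- The lowest Robin eigenvalue of the exterior of `Ω`, defined variationally as the
infimum of Rayleigh quotients over smooth compactly supported test functions that are
not identically zero on the exterior. -/
def robinEig (α : ℝ) (Ω : Set E2) : ℝ :=
  sInf { q : ℝ | ∃ u : E2 → ℝ, ContDiff ℝ (⊤ : ℕ∞) u ∧ HasCompactSupport u ∧
    (∃ x ∈ extDom Ω, u x ≠ 0) ∧
    q = ((∫ x in extDom Ω, ‖fderiv ℝ u x‖ ^ 2) +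
          α * ∫ x in frontier Ω, (u x) ^ 2 ∂(μH[1])) /
        (∫ x in extDom Ω, (u x) ^ 2) }

/-- A planar set has smooth boundary if its topological boundary is the image of a
smooth, periodic, regular, injective (on one period) closed curve. -/
def HasSmoothBoundary (Ω : Set E2) : Prop :=
  ∃ γ : ℝ → E2, ContDiff ℝ (⊤ : ℕ∞) γ ∧ (∀ t, γ (t + 1) = γ t) ∧
    (∀ t, deriv γ t ≠ 0) ∧ InjOn γ (Ico 0 1) ∧ range γ = frontier Ω

/-- The planar cross product. -/
def crossE (a b : E2) : ℝ := a 0 * b 1 - a 1 * b 0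

/-- The ruled map attached to a base curve `p` and a direction field `q`. -/
def ruled (p q : ℝ → E2) (z : ℝ × ℝ) : E2 := p z.1 + z.2 • q z.1

/-- The coordinate pair of a point of the plane. -/
def toPair : E2 ≃ᵐ ℝ × ℝ :=
  (MeasurableEquiv.toLp 2 (Fin 2 → ℝ)).symm.trans MeasurableEquiv.finTwoArrow

lemma measurePreserving_toPair : MeasurePreserving toPair volume volume :=
  (volume_preserving_finTwoArrow ℝ).comp
    (EuclideanSpace.volume_preserving_symm_measurableEquiv_toLp (Fin 2))

lemma hasDerivAt_coord {p : ℝ → E2} {p' : E2} {s : ℝ} (hp : HasDerivAt p p' s) (i : Fin 2) :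
    HasDerivAt (fun s => p s i) (p' i) s :=
  (EuclideanSpace.proj i : E2 →L[ℝ] ℝ).hasFDerivAt.comp_hasDerivAt s hp

/-- The differential of a ruled map in coordinates. -/
def ruledFDeriv (p' q q' : ℝ → E2) (z : ℝ × ℝ) : ℝ × ℝ →L[ℝ] ℝ × ℝ :=
  (Matrix.toLin (.finTwoProd ℝ) (.finTwoProd ℝ)
    !![(p' z.1 + z.2 • q' z.1) 0, q z.1 0;
       (p' z.1 + z.2 • q' z.1) 1, q z.1 1]).toContinuousLinearMap

lemma det_ruledFDeriv (p' q q' : ℝ → E2) (z : ℝ × ℝ) :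
    (ruledFDeriv p' q q' z).det = crossE (p' z.1 + z.2 • q' z.1) (q z.1) := by
  unfold ruledFDeriv crossE
  simp only [LinearMap.det_toContinuousLinearMap, LinearMap.det_toLin, Matrix.det_fin_two_of]
  ring

lemma hasFDerivAt_ruled {p q p' q' : ℝ → E2} (hp : ∀ s, HasDerivAt p (p' s) s)
    (hq : ∀ s, HasDerivAt q (q' s) s) (z : ℝ × ℝ) :
    HasFDerivAt (fun z => toPair (ruled p q z)) (ruledFDeriv p' q q' z) z := by
  unfold ruledFDeriv
  rw [Matrix.toLin_finTwoProd_toContinuousLinearMap]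
  have key : ∀ i : Fin 2, HasFDerivAt (fun z : ℝ × ℝ => p z.1 i + z.2 * q z.1 i)
      ((p' z.1 i) • ContinuousLinearMap.fst ℝ ℝ ℝ +
        (z.2 • ((q' z.1 i) • ContinuousLinearMap.fst ℝ ℝ ℝ) +
          (q z.1 i) • ContinuousLinearMap.snd ℝ ℝ ℝ)) z := fun i =>
    ((hasDerivAt_coord (hp z.1) i).comp_hasFDerivAt z hasFDerivAt_fst).add
      (hasFDerivAt_snd.mul ((hasDerivAt_coord (hq z.1) i).comp_hasFDerivAt z hasFDerivAt_fst))
  have h := (key 0).prodMk (key 1)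
  refine h.congr_fderiv ?_
  ext <;> simp [smul_smul]

lemma volume_image_toPair (S : Set E2) : volume (toPair '' S) = volume S := by
  have h := measurePreserving_toPair.measure_preimage_equiv (f := toPair) (toPair '' S)
  rw [← h, toPair.injective.preimage_image]

lemma volume_image_ruled_le {p q p' q' : ℝ → E2} (hp : ∀ s, HasDerivAt p (p' s) s)
    (hq : ∀ s, HasDerivAt q (q' s) s) {S : Set (ℝ × ℝ)} (hS : MeasurableSet S) :
    volume (ruled p q '' S) ≤
      ∫⁻ z in S, ENNReal.ofReal |crossE (p' z.1 + z.2 • q' z.1) (q z.1)| := by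
  have h := addHaar_image_le_lintegral_abs_det_fderiv (volume : Measure (ℝ × ℝ)) hS
    (fun z _ => (hasFDerivAt_ruled hp hq z).hasFDerivWithinAt)
  simp only [det_ruledFDeriv] at h
  rwa [← volume_image_toPair, image_image]

lemma lintegral_image_ruled {p q p' q' : ℝ → E2} (hp : ∀ s, HasDerivAt p (p' s) s)
    (hq : ∀ s, HasDerivAt q (q' s) s) {S : Set (ℝ × ℝ)} (hS : MeasurableSet S)
    (hinj : InjOn (ruled p q) S) (F : E2 → ENNReal) :
    ∫⁻ x in ruled p q '' S, F x =
      ∫⁻ z in S, ENNReal.ofReal |crossE (p' z.1 + z.2 • q' z.1) (q z.1)| * F (ruled p q z) := by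
  have h := lintegral_image_eq_lintegral_abs_det_fderiv_mul (volume : Measure (ℝ × ℝ)) hS
    (fun z _ => (hasFDerivAt_ruled hp hq z).hasFDerivWithinAt)
    (toPair.injective.comp_injOn hinj) (fun y => F (toPair.symm y))
  simp only [det_ruledFDeriv, MeasurableEquiv.symm_apply_apply] at h
  rw [← h]
  have h2 := measurePreserving_toPair.setLIntegral_comp_emb toPair.measurableEmbedding
    (fun y => F (toPair.symm y)) (ruled p q '' S)
  simp only [MeasurableEquiv.symm_apply_apply, image_image] at h2
  exact h2

/-- `β` is a smooth 1-periodic parametrization of the boundary of `Ω` with constant speed `L`. -/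
structure IsArcBoundary (Ω : Set E2) (β : ℝ → E2) (L : ℝ) : Prop where
  smooth : ContDiff ℝ (⊤ : ℕ∞) β
  periodic : ∀ t, β (t + 1) = β t
  pos : 0 < L
  speed : ∀ t, ‖deriv β t‖ = L
  inj : InjOn β (Ico 0 1)
  range_eq : range β = frontier Ω

lemma periodic_deriv {f : ℝ → E2} (h : ∀ t, f (t + 1) = f t) (t : ℝ) :
    deriv f (t + 1) = deriv f t := by
  rw [← deriv_comp_add_const]
  exact congrArg (fun g => deriv g t) (funext h)

lemma HasSmoothBoundary.exists_isArcBoundary {Ω : Set E2} (h : HasSmoothBoundary Ω) :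
    ∃ β L, IsArcBoundary Ω β L := by
  obtain ⟨γ, hγ, hper, hreg, hinj, hrange⟩ := h
  have hdγ : ContDiff ℝ (⊤ : ℕ∞) (deriv γ) :=
    ((contDiff_infty_iff_deriv (𝕜 := ℝ)).1 hγ).2
  have hv : ContDiff ℝ (⊤ : ℕ∞) (fun t => ‖deriv γ t‖) :=
    hdγ.norm ℝ hreg
  have hvc : Continuous (fun t => ‖deriv γ t‖) := hv.continuous
  have hvpos : ∀ t, 0 < ‖deriv γ t‖ := fun t => norm_pos_iff.2 (hreg t)
  have hvper : Function.Periodic (fun t => ‖deriv γ t‖) 1 := fun t => by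
    simp only [periodic_deriv hper]
  set L : ℝ := ∫ t in (0:ℝ)..1, ‖deriv γ t‖ with hL
  have hLpos : 0 < L := intervalIntegral.intervalIntegral_pos_of_pos
    (hvc.intervalIntegrable _ _) hvpos one_pos
  set ℓ : ℝ → ℝ := fun s => (∫ t in (0:ℝ)..s, ‖deriv γ t‖) / L with hℓ
  have hℓd : ∀ s, HasDerivAt ℓ (‖deriv γ s‖ / L) s := fun s =>
    (hvc.integral_hasStrictDerivAt 0 s).hasDerivAt.div_const L
  have hℓsmooth : ContDiff ℝ (⊤ : ℕ∞) ℓ := by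
    rw [contDiff_infty_iff_deriv]
    refine ⟨fun s => (hℓd s).differentiableAt, ?_⟩
    have : deriv ℓ = fun s => ‖deriv γ s‖ / L := funext fun s => (hℓd s).deriv
    rw [this]
    exact hv.div_const L
  have hℓmono : StrictMono ℓ := strictMono_of_deriv_pos fun s => by
    rw [(hℓd s).deriv]; exact div_pos (hvpos s) hLpos
  have hℓper : ∀ s, ℓ (s + 1) = ℓ s + 1 := fun s => by
    simp only [hℓ]
    rw [← intervalIntegral.integral_add_adjacent_intervals
      (hvc.intervalIntegrable 0 s) (hvc.intervalIntegrable s (s+1)),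
      hvper.intervalIntegral_add_eq s 0, zero_add, add_div, div_self hLpos.ne']
  have hℓ0 : ℓ 0 = 0 := by simp [hℓ]
  have hℓnat : ∀ n : ℕ, ∀ s, ℓ (s + n) = ℓ s + n := by
    intro n
    induction n with
    | zero => simp
    | succ n ih => intro s; push_cast; rw [← add_assoc, hℓper, ih]; ring
  have hsurj : Function.Surjective ℓ := by
    intro y
    obtain ⟨n, hn⟩ := exists_nat_ge |y|
    have h1 : ℓ n = n := by simpa [hℓ0] using hℓnat n 0
    have h2 : ℓ (-n) = -n := by
      have := hℓnat n (-n)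
      rw [neg_add_cancel, hℓ0] at this
      linarith
    have := intermediate_value_Icc (a := (-n : ℝ)) (b := n) (by linarith [abs_nonneg y])
      hℓsmooth.continuous.continuousOn
    rw [h1, h2] at this
    obtain ⟨x, -, hx⟩ := this (show y ∈ Icc (-n : ℝ) n from
      ⟨by linarith [neg_abs_le y], by linarith [le_abs_self y]⟩)
    exact ⟨x, hx⟩
  set e : ℝ ≃ₜ ℝ := (hℓmono.orderIsoOfSurjective ℓ hsurj).toHomeomorph with he
  have hecoe : ⇑e = ℓ := rfl
  have hesm : ContDiff ℝ (⊤ : ℕ∞) e.symm :=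
    e.contDiff_symm_deriv (f' := fun s => ‖deriv γ s‖ / L)
      (fun s => (div_pos (hvpos s) hLpos).ne') hℓd hℓsmooth
  have hes : ∀ t, ℓ (e.symm t) = t := fun t => e.apply_symm_apply t
  have hed : ∀ t, HasDerivAt e.symm (‖deriv γ (e.symm t)‖ / L)⁻¹ t := fun t =>
    HasDerivAt.of_local_left_inverse e.symm.continuous.continuousAt (hℓd _)
      (div_pos (hvpos _) hLpos).ne' (Eventually.of_forall hes)
  have hβd : ∀ t, HasDerivAt (γ ∘ e.symm)
      ((‖deriv γ (e.symm t)‖ / L)⁻¹ • deriv γ (e.symm t)) t := fun t =>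
    ((hγ.differentiable (by simp)) _).hasDerivAt.scomp t (hed t)
  refine ⟨γ ∘ e.symm, L, hγ.comp hesm, fun t => ?_, hLpos, fun t => ?_, ?_, ?_⟩
  · have : e.symm (t + 1) = e.symm t + 1 := by
      apply hℓmono.injective
      rw [hes, hℓper, hes]
    simp only [Function.comp, this, hper]
  · rw [(hβd t).deriv, norm_smul, norm_inv, norm_div, norm_norm, Real.norm_of_nonneg hLpos.le,
      inv_div, div_mul_cancel₀ _ (hvpos _).ne']
  · refine hinj.comp e.symm.injective.injOn fun t ht => ?_
    have h1 : ℓ 1 = 1 := by simpa [hℓ0] using hℓper 0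
    exact ⟨hℓmono.le_iff_le.1 (by rw [hes, hℓ0]; exact ht.1),
      hℓmono.lt_iff_lt.1 (by rw [hes, h1]; exact ht.2)⟩
  · rw [EquivLike.range_comp γ e.symm, hrange]

lemma normSq_E2 (a : E2) : ‖a‖ ^ 2 = a 0 ^ 2 + a 1 ^ 2 := by
  rw [EuclideanSpace.norm_sq_eq]; simp [Fin.sum_univ_two]

lemma inner_E2 (a b : E2) : inner ℝ a b = a 0 * b 0 + a 1 * b 1 := by
  simp [PiLp.inner_apply, Fin.sum_univ_two, mul_comm]

lemma hasDerivAt_of_coord {p : ℝ → E2} {p' : E2} {s : ℝ}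
    (h : ∀ i, HasDerivAt (fun s => p s i) (p' i) s) : HasDerivAt p p' s :=
  ((PiLp.continuousLinearEquiv 2 ℝ (fun _ : Fin 2 => ℝ)).symm :
    (Fin 2 → ℝ) →L[ℝ] E2).hasFDerivAt.comp_hasDerivAt s (hasDerivAt_pi.2 h)

lemma continuous_crossE {f g : ℝ → E2} (hf : Continuous f) (hg : Continuous g) :
    Continuous fun t => crossE (f t) (g t) := by
  unfold crossE; fun_prop

lemma hasDerivAt_crossE {f g : ℝ → E2} {f' g' : E2} {t : ℝ} (hf : HasDerivAt f f' t)
    (hg : HasDerivAt g g' t) :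
    HasDerivAt (fun t => crossE (f t) (g t)) (crossE f' (g t) + crossE (f t) g') t := by
  have h := ((hasDerivAt_coord hf 0).mul (hasDerivAt_coord hg 1)).sub
    ((hasDerivAt_coord hf 1).mul (hasDerivAt_coord hg 0))
  refine h.congr_deriv ?_
  simp only [crossE]; ring

namespace IsArcBoundary

variable {Ω : Set E2} {β : ℝ → E2} {L : ℝ}

lemma hasDerivAt (h : IsArcBoundary Ω β L) (t : ℝ) : HasDerivAt β (deriv β t) t :=
  (h.smooth.differentiable (by simp) t).hasDerivAt

lemma smooth_deriv (h : IsArcBoundary Ω β L) : ContDiff ℝ (⊤ : ℕ∞) (deriv β) :=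
  ((contDiff_infty_iff_deriv (𝕜 := ℝ)).1 h.smooth).2

lemma hasDerivAt_deriv (h : IsArcBoundary Ω β L) (t : ℝ) :
    HasDerivAt (deriv β) (deriv (deriv β) t) t :=
  (h.smooth_deriv.differentiable (by simp) t).hasDerivAt

lemma continuous_deriv (h : IsArcBoundary Ω β L) : Continuous (deriv β) :=
  h.smooth_deriv.continuous

lemma mem_frontier (h : IsArcBoundary Ω β L) (t : ℝ) : β t ∈ frontier Ω :=
  h.range_eq ▸ mem_range_self t

lemma exists_param (h : IsArcBoundary Ω β L) {y : E2} (hy : y ∈ frontier Ω) :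
    ∃ t ∈ Ico (0 : ℝ) 1, β t = y := by
  rw [← h.range_eq] at hy
  obtain ⟨s, rfl⟩ := hy
  obtain ⟨t, ht, hts⟩ :=
    Function.Periodic.exists_mem_Ico₀ (f := β) (c := 1) h.periodic one_pos s
  exact ⟨t, ht, hts.symm⟩

lemma speed_sq (h : IsArcBoundary Ω β L) (t : ℝ) :
    deriv β t 0 ^ 2 + deriv β t 1 ^ 2 = L ^ 2 := by
  rw [← normSq_E2, h.speed]

lemma exists_support_functional (h : IsArcBoundary Ω β L) (hconv : Convex ℝ Ω) (ho : IsOpen Ω)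
    (s : ℝ) : ∃ c : ℝ, ∀ y ∈ Ω, c * crossE (y - β s) (deriv β s) < 0 := by
  have hs : β s ∉ Ω := fun hmem => (h.mem_frontier s).2 (by rwa [ho.interior_eq])
  obtain ⟨f, hf⟩ := geometric_hahn_banach_open_point hconv ho hs
  have hf' : ∀ a ∈ closure Ω, f a ≤ f (β s) :=
    fun a ha => closure_minimal (fun a ha => (hf a ha).le)
      (isClosed_le f.continuous continuous_const) ha
  have hmax : IsLocalMax (fun t => f (β t)) s :=
    Eventually.of_forall fun t => hf' _ (h.mem_frontier t).1
  have hd : f (deriv β s) = 0 :=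
    hmax.hasDerivAt_eq_zero (f.hasFDerivAt.comp_hasDerivAt s (h.hasDerivAt s))
  have hcoord : ∀ y : E2, f y = y 0 * f (EuclideanSpace.single 0 1) +
      y 1 * f (EuclideanSpace.single 1 1) := fun y => by
    have : y = y 0 • EuclideanSpace.single 0 (1 : ℝ) + y 1 • EuclideanSpace.single 1 (1 : ℝ) := by
      ext i; fin_cases i <;> simp
    conv_lhs => rw [this]
    simp
  rw [hcoord] at hd
  have hL := h.pos
  set f0 := f (EuclideanSpace.single 0 1)
  set f1 := f (EuclideanSpace.single 1 1)
  refine ⟨(f0 * deriv β s 1 - f1 * deriv β s 0) / L ^ 2, fun y hy => ?_⟩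
  have h1 := hf y hy
  have h2 : (f0 * deriv β s 1 - f1 * deriv β s 0) / L ^ 2 * crossE (y - β s) (deriv β s) =
      f y - f (β s) := by
    rw [hcoord y, hcoord (β s), div_mul_eq_mul_div, div_eq_iff (by positivity), ← h.speed_sq s]
    simp only [crossE, PiLp.sub_apply]
    linear_combination (-(y 0 - β s 0) * deriv β s 0 - (y 1 - β s 1) * deriv β s 1) * hd
  rw [h2]; linarith

/-- The orientation sign of the boundary parametrization of a convex domain. -/
lemma exists_orientation (h : IsArcBoundary Ω β L) (hconv : Convex ℝ Ω) (ho : IsOpen Ω)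
    {o : E2} (hoΩ : o ∈ Ω) :
    ∃ σ : ℝ, σ ^ 2 = 1 ∧ ∀ s, ∀ y ∈ Ω, σ * crossE (y - β s) (deriv β s) < 0 := by
  choose c hc using h.exists_support_functional hconv ho
  set D : ℝ → ℝ := fun s => crossE (o - β s) (deriv β s) with hD
  have hDc : Continuous D :=
    continuous_crossE (continuous_const.sub h.smooth.continuous) h.continuous_deriv
  have hD0 : ∀ s, D s ≠ 0 := fun s h0 => by
    have := hc s o hoΩ
    simp only [hD] at h0
    rw [h0, mul_zero] at this
    exact lt_irrefl _ this
  have hsign : ∃ σ : ℝ, σ ^ 2 = 1 ∧ ∀ s, σ * D s < 0 := by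
    rcases lt_or_gt_of_ne (hD0 0) with h0 | h0
    · refine ⟨1, one_pow 2, fun s => ?_⟩
      by_contra! hs
      obtain ⟨t, ht⟩ := mem_range_of_exists_le_of_exists_ge hDc ⟨0, h0.le⟩ ⟨s, by simpa using hs⟩
      exact hD0 t ht
    · refine ⟨-1, by norm_num, fun s => ?_⟩
      by_contra! hs
      obtain ⟨t, ht⟩ := mem_range_of_exists_le_of_exists_ge hDc ⟨s, by linarith⟩ ⟨0, h0.le⟩
      exact hD0 t ht
  obtain ⟨σ, hσ, hσD⟩ := hsign
  refine ⟨σ, hσ, fun s y hy => ?_⟩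
  have h1 := hc s o hoΩ
  have h2 := hc s y hy
  have h3 := hσD s
  simp only [hD] at h3
  have h4 := mul_pos_of_neg_of_neg h1 h3
  have hcσ : 0 < c s * σ := by
    have : 0 < (c s * σ) * (crossE (o - β s) (deriv β s)) ^ 2 := by linarith
    exact pos_of_mul_pos_left this (sq_nonneg _)
  have h5 : σ * crossE (y - β s) (deriv β s) * (c s * σ) = c s * crossE (y - β s) (deriv β s) := by
    linear_combination c s * crossE (y - β s) (deriv β s) * hσ
  by_contra! h6
  have := mul_nonneg h6 hcσ.le
  linarith

lemma orientation_le {σ : ℝ}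
    (hσ : ∀ s, ∀ y ∈ Ω, σ * crossE (y - β s) (deriv β s) < 0) (s : ℝ) {y : E2}
    (hy : y ∈ closure Ω) : σ * crossE (y - β s) (deriv β s) ≤ 0 := by
  refine closure_minimal (t := {y | σ * crossE (y - β s) (deriv β s) ≤ 0})
    (fun y hy => (hσ s y hy).le) (isClosed_le ?_ continuous_const) hy
  unfold crossE; fun_prop

end IsArcBoundary

/-- The unit normal field of a curve with speed `L`, with orientation sign `σ`. -/
def normalE (β : ℝ → E2) (L σ : ℝ) (s : ℝ) : E2 :=
  (σ / L) • !₂[deriv β s 1, -(deriv β s 0)]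

/-- The derivative of the unit normal field. -/
def normalE' (β : ℝ → E2) (L σ : ℝ) (s : ℝ) : E2 :=
  (σ / L) • !₂[deriv (deriv β) s 1, -(deriv (deriv β) s 0)]

namespace IsArcBoundary

variable {Ω : Set E2} {β : ℝ → E2} {L : ℝ}

lemma hasDerivAt_normalE (h : IsArcBoundary Ω β L) (σ s : ℝ) :
    HasDerivAt (normalE β L σ) (normalE' β L σ s) s := by
  refine HasDerivAt.const_smul (σ / L) (hasDerivAt_of_coord fun i => ?_)
  fin_cases i
  · exact hasDerivAt_coord (h.hasDerivAt_deriv s) 1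
  · exact (hasDerivAt_coord (h.hasDerivAt_deriv s) 0).neg

lemma norm_normalE (h : IsArcBoundary Ω β L) {σ : ℝ} (hσ : σ ^ 2 = 1) (s : ℝ) :
    ‖normalE β L σ s‖ = 1 := by
  have hL := h.pos
  rw [← sq_eq_sq₀ (norm_nonneg _) zero_le_one, normSq_E2, normalE]
  simp only [PiLp.smul_apply, smul_eq_mul, Matrix.cons_val_zero,
    Matrix.cons_val_one]
  have := h.speed_sq s
  field_simp
  linear_combination L ^ 2 * hσ + σ ^ 2 * this

lemma crossE_normalE (h : IsArcBoundary Ω β L) (σ s : ℝ) :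
    crossE (deriv β s) (normalE β L σ s) = -(σ * L) := by
  have hL := h.pos
  simp only [crossE, normalE, PiLp.smul_apply, smul_eq_mul,
    Matrix.cons_val_zero, Matrix.cons_val_one]
  have := h.speed_sq s
  field_simp
  linear_combination -σ * this

end IsArcBoundary

namespace IsArcBoundary

variable {Ω : Set E2} {β : ℝ → E2} {L : ℝ}

lemma infDist_pos {x : E2} (hne : Ω.Nonempty) (hx : x ∈ extDom Ω) : 0 < infDist x Ω := by
  rw [← infDist_closure]
  exact (isClosed_closure.notMem_iff_infDist_pos hne.closure).1 hx

lemma frontier_compl_closure_subset (Ω : Set E2) : frontier (closure Ω)ᶜ ⊆ frontier Ω := by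
  rw [frontier_compl]; exact frontier_closure_subset

/-- Every exterior point is reached from the boundary along a normal, at its distance. -/
lemma exists_normal_param (h : IsArcBoundary Ω β L) (hconv : Convex ℝ Ω)
    {o : E2} (hoΩ : o ∈ Ω) {σ : ℝ} (hσ2 : σ ^ 2 = 1)
    (hσ : ∀ s, ∀ y ∈ Ω, σ * crossE (y - β s) (deriv β s) < 0) {x : E2} (hx : x ∈ extDom Ω) :
    ∃ s ∈ Ico (0 : ℝ) 1, x = β s + infDist x Ω • normalE β L σ s := by
  have hL := h.pos
  have hne : (closure Ω).Nonempty := ⟨o, subset_closure hoΩ⟩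
  have hd := infDist_pos ⟨o, hoΩ⟩ hx
  have huniv : (closure Ω)ᶜ ≠ univ := fun h0 => by
    rw [compl_univ_iff] at h0; exact hne.ne_empty h0
  obtain ⟨y, hy, hxy⟩ := exists_mem_frontier_infDist_compl_eq_dist
    (s := (closure Ω)ᶜ) hx huniv
  rw [compl_compl, infDist_closure] at hxy
  obtain ⟨t, ht, rfl⟩ := h.exists_param (frontier_compl_closure_subset Ω hy)
  have hmem : β t ∈ closure Ω := (h.mem_frontier t).1
  have : Nonempty (closure Ω) := hne.to_subtype
  have hproj := (norm_eq_iInf_iff_real_inner_le_zero hconv.closure (u := x) hmem).1 (by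
    rw [← dist_eq_norm, ← hxy, ← infDist_closure, infDist_eq_iInf]
    simp only [dist_eq_norm])
  have hmax : IsLocalMax (fun τ => inner ℝ (x - β t) (β τ - β t)) t :=
    Eventually.of_forall fun τ => by
      simpa using hproj (β τ) (h.mem_frontier τ).1
  have hortho : inner ℝ (x - β t) (deriv β t) = 0 :=
    hmax.hasDerivAt_eq_zero ((innerSL ℝ (x - β t)).hasFDerivAt.comp_hasDerivAt t
      ((h.hasDerivAt t).sub_const (β t)))
  have ho := hproj o (subset_closure hoΩ)
  have hso := hσ t o hoΩ
  have hsp := h.speed_sq t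
  rw [inner_E2] at hortho ho
  simp only [PiLp.sub_apply] at hortho ho
  simp only [crossE, PiLp.sub_apply] at hso
  set a : ℝ := (σ / L) * ((x 0 - β t 0) * deriv β t 1 - (x 1 - β t 1) * deriv β t 0) with ha
  have hx0 : x 0 - β t 0 = a * ((σ / L) * deriv β t 1) := by
    rw [ha]; field_simp
    linear_combination (-(x 0 - β t 0) * L ^ 2) * hσ2 -
      σ ^ 2 * (x 0 - β t 0) * hsp + σ ^ 2 * deriv β t 0 * hortho
  have hx1 : x 1 - β t 1 = a * ((σ / L) * -(deriv β t 0)) := by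
    rw [ha]; field_simp
    linear_combination (-(x 1 - β t 1) * L ^ 2) * hσ2 -
      σ ^ 2 * (x 1 - β t 1) * hsp + σ ^ 2 * deriv β t 1 * hortho
  have hxa : x = β t + a • normalE β L σ t := by
    ext i; fin_cases i
    · simp only [normalE, PiLp.add_apply, PiLp.smul_apply, smul_eq_mul]
      simpa using (eq_add_of_sub_eq' hx0)
    · simp only [normalE, PiLp.add_apply, PiLp.smul_apply, smul_eq_mul]
      simpa using (eq_add_of_sub_eq' hx1)
  have ha0 : 0 ≤ a := by
    rw [hx0, hx1] at ho
    by_contra! hneg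
    have : a * (σ / L) * ((o 0 - β t 0) * deriv β t 1 - (o 1 - β t 1) * deriv β t 0) ≤ 0 := by
      linarith
    have h2 : 0 < (a / L) * (σ * ((o 0 - β t 0) * deriv β t 1 - (o 1 - β t 1) * deriv β t 0)) :=
      mul_pos_of_neg_of_neg (div_neg_of_neg_of_pos hneg hL) hso
    have h3 : (a / L) * (σ * ((o 0 - β t 0) * deriv β t 1 - (o 1 - β t 1) * deriv β t 0)) =
      a * (σ / L) * ((o 0 - β t 0) * deriv β t 1 - (o 1 - β t 1) * deriv β t 0) := by ring
    linarith
  have hda : infDist x Ω = a := by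
    rw [hxy, dist_eq_norm]
    nth_rewrite 1 [hxa]
    rw [add_sub_cancel_left, norm_smul, h.norm_normalE hσ2, mul_one, Real.norm_of_nonneg ha0]
  exact ⟨t, ht, by rw [hda]; exact hxa⟩

lemma continuous_normalE (h : IsArcBoundary Ω β L) (σ : ℝ) : Continuous (normalE β L σ) :=
  continuous_iff_continuousAt.2 fun s => (h.hasDerivAt_normalE σ s).continuousAt

lemma continuous_normalE' (h : IsArcBoundary Ω β L) (σ : ℝ) : Continuous (normalE' β L σ) := by
  have h2 : Continuous (deriv (deriv β)) :=
    (((contDiff_infty_iff_deriv (𝕜 := ℝ)).1 h.smooth_deriv).2).continuous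
  unfold normalE'
  fun_prop

lemma crossE_normalE'_of_eq (h : IsArcBoundary Ω β L) {σ : ℝ} (hσ2 : σ ^ 2 = 1)
    (hσ : ∀ s, ∀ y ∈ Ω, σ * crossE (y - β s) (deriv β s) < 0) {s₁ s₂ : ℝ}
    (hβ : β s₁ ≠ β s₂) (hn : normalE β L σ s₁ = normalE β L σ s₂) :
    crossE (normalE' β L σ s₁) (normalE β L σ s₁) = 0 := by
  have hL := h.pos
  have hσ0 : σ ≠ 0 := by rintro rfl; norm_num at hσ2
  have hd : deriv β s₁ = deriv β s₂ := by
    have h2 := smul_right_injective E2 (div_ne_zero hσ0 hL.ne') hn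
    ext i; fin_cases i
    · simpa using congrArg (fun v : E2 => v 1) h2
    · simpa using congrArg (fun v : E2 => v 0) h2
  have h1 := orientation_le hσ s₁ (h.mem_frontier s₂).1
  have h2 := orientation_le hσ s₂ (h.mem_frontier s₁).1
  have hsp := h.speed_sq s₁
  have hzero : σ * crossE (β s₂ - β s₁) (deriv β s₁) = 0 := by
    rw [← hd] at h2
    refine le_antisymm h1 ?_
    have : crossE (β s₁ - β s₂) (deriv β s₁) = - crossE (β s₂ - β s₁) (deriv β s₁) := by
      simp only [crossE, PiLp.sub_apply]; ring
    rw [this] at h2; linarith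
  have hcross : crossE (β s₂ - β s₁) (deriv β s₁) = 0 :=
    (mul_eq_zero.1 hzero).resolve_left hσ0
  have hmax : IsLocalMax (fun s => σ * crossE (β s₂ - β s) (deriv β s)) s₁ :=
    Eventually.of_forall fun s => by
      simp only [hzero]; exact orientation_le hσ s (h.mem_frontier s₂).1
  have hder := hmax.hasDerivAt_eq_zero
    ((hasDerivAt_crossE ((h.hasDerivAt s₁).const_sub (β s₂)) (h.hasDerivAt_deriv s₁)).const_mul σ)
  have hder' := (mul_eq_zero.1 hder).resolve_left hσ0
  simp only [crossE, PiLp.sub_apply, PiLp.neg_apply] at hder' hcross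
  set b := deriv β s₁
  set b' := deriv (deriv β) s₁
  set w0 := β s₂ 0 - β s₁ 0 with hw0
  set w1 := β s₂ 1 - β s₁ 1 with hw1
  have e0 : (w0 * b 0 + w1 * b 1) * (b 0 * b' 1 - b 1 * b' 0) = 0 := by
    linear_combination (b 0 ^ 2 + b 1 ^ 2) * hder' - (b 0 * b' 0 + b 1 * b' 1) * hcross
  have hne : w0 * b 0 + w1 * b 1 ≠ 0 := by
    intro h0
    apply hβ
    have hw : w0 * L ^ 2 = 0 := by rw [← hsp]; linear_combination b 0 * h0 + b 1 * hcross
    have hw' : w1 * L ^ 2 = 0 := by rw [← hsp]; linear_combination b 1 * h0 - b 0 * hcross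
    have hL2 : L ^ 2 ≠ 0 := by positivity
    have hw := (mul_eq_zero.1 hw).resolve_right hL2
    have hw' := (mul_eq_zero.1 hw').resolve_right hL2
    ext i; fin_cases i
    · simp only [Fin.zero_eta]; linarith
    · simp only [Fin.mk_one]; linarith
  have e1 := (mul_eq_zero.1 e0).resolve_left hne
  simp only [crossE, normalE, normalE', PiLp.smul_apply, smul_eq_mul,
    Matrix.cons_val_zero, Matrix.cons_val_one]
  linear_combination (-(σ / L) ^ 2) * e1

/-- The total curvature of the boundary of a convex domain is at most `2 * π`. -/
lemma lintegral_curvature_le (h : IsArcBoundary Ω β L) {σ : ℝ} (hσ2 : σ ^ 2 = 1)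
    (hσ : ∀ s, ∀ y ∈ Ω, σ * crossE (y - β s) (deriv β s) < 0) :
    ∫⁻ s in Ico (0 : ℝ) 1, ENNReal.ofReal |crossE (normalE' β L σ s) (normalE β L σ s)| ≤
      ENNReal.ofReal (2 * π) := by
  set κ : ℝ → ℝ := fun s => crossE (normalE' β L σ s) (normalE β L σ s) with hκ
  have hκc : Continuous κ := continuous_crossE (h.continuous_normalE' σ) (h.continuous_normalE σ)
  set A : Set ℝ := Ico (0 : ℝ) 1 ∩ {s | κ s ≠ 0} with hA
  have hAm : MeasurableSet A :=
    measurableSet_Ico.inter (hκc.measurable (measurableSet_singleton 0).compl)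
  have hinj : InjOn (ruled 0 (normalE β L σ)) (A ×ˢ Ioo (0 : ℝ) 1) := by
    rintro ⟨s₁, r₁⟩ ⟨hs₁, hr₁⟩ ⟨s₂, r₂⟩ ⟨hs₂, hr₂⟩ heq
    simp only [ruled, Pi.zero_apply, zero_add] at heq hr₁ hr₂
    have hr : r₁ = r₂ := by
      have := congrArg norm heq
      rwa [norm_smul, norm_smul, h.norm_normalE hσ2, h.norm_normalE hσ2, mul_one, mul_one,
        Real.norm_of_nonneg hr₁.1.le, Real.norm_of_nonneg hr₂.1.le] at this
    subst hr
    have hn : normalE β L σ s₁ = normalE β L σ s₂ := smul_right_injective E2 hr₁.1.ne' heq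
    have hs : s₁ = s₂ := by
      by_contra hne
      exact hs₁.2 (h.crossE_normalE'_of_eq hσ2 hσ
        (fun hb => hne (h.inj hs₁.1 hs₂.1 hb)) hn)
    rw [hs]
  have hcov := lintegral_image_ruled (p := 0) (p' := 0) (fun s => hasDerivAt_const s 0)
    (h.hasDerivAt_normalE σ) (hAm.prod measurableSet_Ioo) hinj 1
  have hball : ∫⁻ x in ruled 0 (normalE β L σ) '' (A ×ˢ Ioo (0 : ℝ) 1), (1 : E2 → ENNReal) x ≤
      ENNReal.ofReal π := by
    simp only [Pi.one_apply, setLIntegral_one]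
    calc _ ≤ volume (ball (0 : E2) 1) := measure_mono ?_
      _ = ENNReal.ofReal π := by
        rw [EuclideanSpace.volume_ball_fin_two]; simp
    rintro _ ⟨⟨s, r⟩, ⟨-, hr⟩, rfl⟩
    simp only [ruled, Pi.zero_apply, zero_add, mem_ball_zero_iff]
    rw [norm_smul, h.norm_normalE hσ2, mul_one, Real.norm_of_nonneg hr.1.le]
    exact hr.2
  rw [hcov] at hball
  have hprod : ∫⁻ z in A ×ˢ Ioo (0 : ℝ) 1, ENNReal.ofReal (|κ z.1| * z.2) =
      (∫⁻ s in A, ENNReal.ofReal |κ s|) * ∫⁻ r in Ioo (0 : ℝ) 1, ENNReal.ofReal r := by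
    rw [Measure.volume_eq_prod, ← Measure.prod_restrict, ← lintegral_prod_mul
      (by fun_prop) (by fun_prop)]
    refine lintegral_congr fun z => ?_
    rw [ENNReal.ofReal_mul (abs_nonneg _)]
  have hhalf : ∫⁻ r in Ioo (0 : ℝ) 1, ENNReal.ofReal r = ENNReal.ofReal (1 / 2) := by
    rw [← ofReal_integral_eq_lintegral_ofReal, ← integral_Ioc_eq_integral_Ioo,
      ← intervalIntegral.integral_of_le zero_le_one, integral_id]
    · norm_num
    · exact (continuous_id.integrableOn_Icc).mono_set Ioo_subset_Icc_self
    · exact (ae_restrict_iff' measurableSet_Ioo).2 (Eventually.of_forall fun r hr => hr.1.le)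
  have hAI : ∫⁻ s in Ico (0 : ℝ) 1, ENNReal.ofReal |κ s| = ∫⁻ s in A, ENNReal.ofReal |κ s| := by
    have hB : MeasurableSet {s | κ s ≠ 0} := hκc.measurable (measurableSet_singleton 0).compl
    have hind : (fun s => ENNReal.ofReal |κ s|) =
        {s | κ s ≠ 0}.indicator fun s => ENNReal.ofReal |κ s| := by
      ext s
      by_cases hs : κ s = 0 <;> simp [indicator, hs]
    conv_lhs => rw [hind]
    rw [lintegral_indicator hB, Measure.restrict_restrict hB, inter_comm]
  have hle : (∫⁻ s in A, ENNReal.ofReal |κ s|) * ENNReal.ofReal (1 / 2) ≤ ENNReal.ofReal π := by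
    rw [← hhalf, ← hprod]
    refine le_trans (le_of_eq ?_) hball
    refine setLIntegral_congr_fun (hAm.prod measurableSet_Ioo) fun z hz => ?_
    have : crossE ((0 : ℝ → E2) z.1 + z.2 • normalE' β L σ z.1) (normalE β L σ z.1) =
        κ z.1 * z.2 := by
      simp only [hκ, crossE, Pi.zero_apply, zero_add, PiLp.smul_apply, smul_eq_mul]; ring
    simp only [Pi.one_apply, mul_one]
    rw [this, abs_mul, abs_of_pos hz.2.1]
  rw [hAI]
  calc ∫⁻ s in A, ENNReal.ofReal |κ s|
      = (∫⁻ s in A, ENNReal.ofReal |κ s|) * ENNReal.ofReal (1 / 2) * ENNReal.ofReal 2 := by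
        rw [mul_assoc, ← ENNReal.ofReal_mul (by norm_num)]; norm_num
    _ ≤ ENNReal.ofReal π * ENNReal.ofReal 2 := by gcongr
    _ = ENNReal.ofReal (2 * π) := by rw [← ENNReal.ofReal_mul pi_pos.le, mul_comm]

/-- Steiner-type upper bound for integrals of functions of the distance over the exterior. -/
lemma lintegral_infDist_le (h : IsArcBoundary Ω β L) (hconv : Convex ℝ Ω) (ho : IsOpen Ω)
    {o : E2} (hoΩ : o ∈ Ω) {g : ℝ → ENNReal} (hg : Measurable g) :
    ∫⁻ x in extDom Ω, g (infDist x Ω) ≤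
      ∫⁻ t in Ioi (0 : ℝ), ENNReal.ofReal (L + 2 * π * t) * g t := by
  obtain ⟨σ, hσ2, hσ⟩ := h.exists_orientation hconv ho hoΩ
  have hL := h.pos
  have hσabs : |σ| = 1 := by rw [← sq_eq_sq₀ (abs_nonneg _) zero_le_one, sq_abs, hσ2, one_pow]
  have hdm : Measurable fun x : E2 => infDist x Ω := (continuous_infDist_pt Ω).measurable
  have hem : MeasurableSet (extDom Ω) := isClosed_closure.isOpen_compl.measurableSet
  set κ : ℝ → ℝ := fun s => crossE (normalE' β L σ s) (normalE β L σ s) with hκ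
  have hκc : Continuous κ := continuous_crossE (h.continuous_normalE' σ) (h.continuous_normalE σ)
  have hw : Measurable fun t : ℝ => ENNReal.ofReal (L + 2 * π * t) := by fun_prop
  have hmeas : (volume.restrict (extDom Ω)).map (fun x => infDist x Ω) ≤
      (volume.restrict (Ioi (0 : ℝ))).withDensity (fun t => ENNReal.ofReal (L + 2 * π * t)) := by
    refine Measure.le_iff.2 fun A hA => ?_
    rw [Measure.map_apply hdm hA, Measure.restrict_apply (hdm hA), withDensity_apply _ hA,
      Measure.restrict_restrict hA]
    calc volume ((fun x => infDist x Ω) ⁻¹' A ∩ extDom Ω)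
        ≤ volume (ruled β (normalE β L σ) '' (Ico (0 : ℝ) 1 ×ˢ (A ∩ Ioi 0))) := by
          refine measure_mono ?_
          rintro x ⟨hxA, hx⟩
          obtain ⟨s, hs, hxs⟩ := h.exists_normal_param hconv hoΩ hσ2 hσ hx
          exact ⟨(s, infDist x Ω), ⟨hs, hxA, infDist_pos ⟨o, hoΩ⟩ hx⟩, hxs.symm⟩
      _ ≤ ∫⁻ z in Ico (0 : ℝ) 1 ×ˢ (A ∩ Ioi 0),
            ENNReal.ofReal |crossE (deriv β z.1 + z.2 • normalE' β L σ z.1)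
              (normalE β L σ z.1)| :=
          volume_image_ruled_le h.hasDerivAt (h.hasDerivAt_normalE σ)
            (measurableSet_Ico.prod (hA.inter measurableSet_Ioi))
      _ ≤ ∫⁻ z in Ico (0 : ℝ) 1 ×ˢ (A ∩ Ioi 0), ENNReal.ofReal (L + |κ z.1| * z.2) := by
          refine setLIntegral_mono' (measurableSet_Ico.prod (hA.inter measurableSet_Ioi))
            fun z hz => ENNReal.ofReal_le_ofReal ?_
          have hz2 : 0 < z.2 := hz.2.2
          have e : crossE (deriv β z.1 + z.2 • normalE' β L σ z.1) (normalE β L σ z.1) =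
              crossE (deriv β z.1) (normalE β L σ z.1) + κ z.1 * z.2 := by
            simp only [hκ, crossE, PiLp.add_apply, PiLp.smul_apply, smul_eq_mul]; ring
          rw [e, h.crossE_normalE]
          refine (abs_add_le _ _).trans ?_
          rw [abs_neg, abs_mul, abs_mul, hσabs, one_mul, abs_of_pos hL, abs_of_pos hz2]
      _ = ∫⁻ t in A ∩ Ioi 0, ∫⁻ s in Ico (0 : ℝ) 1, ENNReal.ofReal (L + |κ s| * t) := by
          rw [Measure.volume_eq_prod, ← Measure.prod_restrict, lintegral_prod_symm _ (by fun_prop)]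
      _ ≤ ∫⁻ t in A ∩ Ioi 0, ENNReal.ofReal (L + 2 * π * t) := by
          refine setLIntegral_mono' (hA.inter measurableSet_Ioi) fun t ht => ?_
          have ht0 : 0 < t := ht.2
          calc ∫⁻ s in Ico (0 : ℝ) 1, ENNReal.ofReal (L + |κ s| * t)
              = ∫⁻ s in Ico (0 : ℝ) 1, (ENNReal.ofReal L + ENNReal.ofReal |κ s| *
                  ENNReal.ofReal t) := by
                refine lintegral_congr fun s => ?_
                rw [ENNReal.ofReal_add hL.le (by positivity), ENNReal.ofReal_mul (abs_nonneg _)]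
            _ = ENNReal.ofReal L + (∫⁻ s in Ico (0 : ℝ) 1, ENNReal.ofReal |κ s|) *
                  ENNReal.ofReal t := by
                rw [lintegral_add_left measurable_const, lintegral_mul_const _ (by fun_prop)]
                simp
            _ ≤ ENNReal.ofReal L + ENNReal.ofReal (2 * π) * ENNReal.ofReal t := by
                gcongr
                exact h.lintegral_curvature_le hσ2 hσ
            _ = ENNReal.ofReal (L + 2 * π * t) := by
                rw [← ENNReal.ofReal_mul (by positivity), ← ENNReal.ofReal_add hL.le
                  (by positivity)]
  calc ∫⁻ x in extDom Ω, g (infDist x Ω)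
      = ∫⁻ t, g t ∂((volume.restrict (extDom Ω)).map (fun x => infDist x Ω)) :=
        (lintegral_map hg hdm).symm
    _ ≤ ∫⁻ t, g t ∂((volume.restrict (Ioi (0 : ℝ))).withDensity
          (fun t => ENNReal.ofReal (L + 2 * π * t))) := lintegral_mono' hmeas le_rfl
    _ = _ := by rw [lintegral_withDensity_eq_lintegral_mul _ hw hg]; rfl

end IsArcBoundary

lemma wirtinger {f f' : ℝ → ℝ} (hf : ∀ x, HasDerivAt f (f' x) x) (hf' : Continuous f')
    (hper : f 1 = f 0) (hmean : ∫ x in (0 : ℝ)..1, f x = 0) :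
    4 * π ^ 2 * ∫ x in (0 : ℝ)..1, f x ^ 2 ≤ ∫ x in (0 : ℝ)..1, f' x ^ 2 := by
  have hfc : Continuous f := continuous_iff_continuousAt.2 fun x => (hf x).continuousAt
  have hmem : ∀ {g : ℝ → ℝ}, Continuous g →
      MemLp (fun x => (g x : ℂ)) 2 (volume.restrict (Ioc (0 : ℝ) 1)) := fun {g} hg => by
    have hgc : Continuous fun x => (g x : ℂ) := by fun_prop
    obtain ⟨C, hC⟩ := isCompact_Icc.exists_bound_of_continuousOn
      (s := Icc (0 : ℝ) 1) hgc.continuousOn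
    exact MemLp.of_bound hgc.aestronglyMeasurable C
      ((ae_restrict_iff' measurableSet_Ioc).2
        (Eventually.of_forall fun x hx => hC x (Ioc_subset_Icc_self hx)))
  have h1 := hasSum_sq_fourierCoeffOn zero_lt_one (hmem hfc)
  have h2 := hasSum_sq_fourierCoeffOn zero_lt_one (hmem hf')
  simp only [sub_zero, inv_one, one_smul, Complex.norm_real, norm_eq_abs, sq_abs] at h1 h2
  refine hasSum_le (fun n => ?_) (h1.mul_left _) h2
  rcases eq_or_ne n 0 with rfl | hn
  · have : fourierCoeffOn zero_lt_one (fun x => (f x : ℂ)) 0 = 0 := by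
      rw [fourierCoeffOn_eq_integral]
      simp [intervalIntegral.integral_ofReal, hmean]
    rw [this]; simp
  · have hc := fourierCoeffOn_of_hasDerivAt zero_lt_one hn
      (f := fun x => (f x : ℂ)) (f' := fun x => (f' x : ℂ))
      (fun x _ => (hf x).ofReal_comp)
      ((Complex.continuous_ofReal.comp hf').intervalIntegrable _ _)
    rw [hc, hper]
    have hn1 : (1 : ℝ) ≤ |(n : ℝ)| := by
      exact_mod_cast Int.one_le_abs hn
    simp only [sub_self, mul_zero, zero_sub, Complex.ofReal_one, Complex.ofReal_zero, sub_zero,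
      one_mul, mul_neg, norm_neg, norm_mul, norm_div, norm_one, Complex.norm_I, Complex.norm_real,
      mul_one, Complex.norm_intCast, Complex.norm_ofNat, norm_eq_abs, abs_of_pos pi_pos]
    rw [mul_pow, ← mul_assoc]
    refine mul_le_of_le_one_left (sq_nonneg _) ?_
    rw [div_pow, one_pow, mul_one_div, div_le_one (by positivity)]
    have : 1 ≤ |(n : ℝ)| ^ 2 := one_le_pow₀ hn1
    nlinarith [mul_nonneg (sq_nonneg π) (sub_nonneg.2 this)]

lemma eq_ball_of_frontier_subset_sphere {Ω : Set E2} (hne : Ω.Nonempty) (ho : IsOpen Ω)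
    (hb : IsBounded Ω) {m : E2} {ρ : ℝ} (hρ : 0 < ρ) (hfr : frontier Ω ⊆ sphere m ρ) :
    Ω = ball m ρ := by
  have hsub : Ω ⊆ closedBall m ρ := by
    obtain ⟨z, hz, hmax⟩ := hb.isCompact_closure.exists_isMaxOn hne.closure
      (continuous_id.dist continuous_const : Continuous fun y : E2 => dist y m).continuousOn
    have hzρ : dist z m ≤ ρ := by
      by_cases hzΩ : z ∈ Ω
      · have htend : Tendsto (fun δ : ℝ => z + δ • (z - m)) (nhdsWithin 0 (Ioi 0)) (nhds z) := by
          have : Continuous fun δ : ℝ => z + δ • (z - m) := by fun_prop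
          simpa using (this.tendsto 0).mono_left nhdsWithin_le_nhds
        obtain ⟨δ, hδΩ, hδ⟩ := ((htend.eventually (ho.mem_nhds hzΩ)).and
          self_mem_nhdsWithin).exists
        have hδ' : (0 : ℝ) < δ := hδ
        have := hmax (subset_closure hδΩ)
        simp only [mem_ofPred_eq, dist_eq_norm, id] at this
        have e : z + δ • (z - m) - m = (1 + δ) • (z - m) := by module
        rw [e, norm_smul, Real.norm_of_nonneg (by positivity)] at this
        rw [dist_eq_norm]
        nlinarith [norm_nonneg (z - m)]
      · exact (hfr ⟨hz, by rwa [ho.interior_eq]⟩ : dist z m = ρ).le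
    exact fun y hy => (hmax (subset_closure hy)).trans hzρ
  have hsub' : Ω ⊆ ball m ρ := by
    rw [← interior_closedBall m hρ.ne', ← ho.interior_eq]
    exact interior_mono hsub
  refine hsub'.antisymm ?_
  refine (convex_ball m ρ).isPreconnected.subset_of_closure_inter_subset ho ?_ ?_
  · obtain ⟨y, hy⟩ := hne
    exact ⟨y, hsub' hy, hy⟩
  · rintro y ⟨hy, hyb⟩
    by_contra hyΩ
    have : dist y m = ρ := hfr ⟨hy, by rwa [ho.interior_eq]⟩
    exact (mem_ball.1 hyb).ne this

section radial

variable {Ω : Set E2} {o : E2}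

lemma radial_gauge (hconv : Convex ℝ Ω) (ho : IsOpen Ω) (hoΩ : o ∈ Ω) :
    Convex ℝ ((fun v => o + v) ⁻¹' Ω) ∧ (fun v => o + v) ⁻¹' Ω ∈ nhds (0 : E2) ∧
    (∀ y, y ∈ frontier Ω ↔ gauge ((fun v => o + v) ⁻¹' Ω) (y - o) = 1) ∧
    (∀ y, y ∈ closure Ω ↔ gauge ((fun v => o + v) ⁻¹' Ω) (y - o) ≤ 1) ∧
    (∀ y, y ∈ Ω ↔ gauge ((fun v => o + v) ⁻¹' Ω) (y - o) < 1) := by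
  have hc : Convex ℝ ((fun v => o + v) ⁻¹' Ω) := hconv.translate_preimage_right o
  have hn : (fun v => o + v) ⁻¹' Ω ∈ nhds (0 : E2) :=
    (ho.preimage (continuous_const_add o)).mem_nhds (by simpa using hoΩ)
  refine ⟨hc, hn, fun y => ?_, fun y => ?_, fun y => ?_⟩
  · rw [gauge_eq_one_iff_mem_frontier hc hn]
    have := (Homeomorph.addLeft o).preimage_frontier Ω
    simp only [Homeomorph.coe_addLeft] at this
    rw [← this]; simp
  · rw [gauge_le_one_iff_mem_closure hc hn]
    have := (Homeomorph.addLeft o).preimage_closure Ω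
    simp only [Homeomorph.coe_addLeft] at this
    rw [← this]; simp
  · rw [gauge_lt_one_iff_mem_interior hc hn, (ho.preimage (continuous_const_add o)).interior_eq]
    simp

lemma exists_radial (hconv : Convex ℝ Ω) (ho : IsOpen Ω) (hb : IsBounded Ω) (hoΩ : o ∈ Ω)
    {x : E2} (hx : x ∈ Ω) (hxo : x ≠ o) :
    ∃ y ∈ frontier Ω, ∃ r ∈ Ioo (0 : ℝ) 1, x = o + r • (y - o) := by
  obtain ⟨hc, hn, hfr, -, hΩ⟩ := radial_gauge hconv ho hoΩ
  set S := (fun v => o + v) ⁻¹' Ω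
  have hSb : IsVonNBounded ℝ S := by
    rw [NormedSpace.isVonNBounded_iff]
    have : S = (fun y => -o + y) '' Ω := by
      ext v; simp [S]
    rw [this]
    exact (LipschitzWith.of_dist_le_mul (K := 1) (by simp)).isBounded_image hb
  have hg : 0 < gauge S (x - o) :=
    (gauge_pos (absorbent_nhds_zero hn) hSb).2 (sub_ne_zero.2 hxo)
  refine ⟨o + (gauge S (x - o))⁻¹ • (x - o), ?_, gauge S (x - o), ⟨hg, (hΩ x).1 hx⟩, ?_⟩
  · rw [hfr, add_sub_cancel_left, gauge_smul_of_nonneg (inv_nonneg.2 hg.le), smul_eq_mul,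
      inv_mul_cancel₀ hg.ne']
  · rw [add_sub_cancel_left, smul_smul, mul_inv_cancel₀ hg.ne', one_smul, add_sub_cancel]

lemma radial_injective (hconv : Convex ℝ Ω) (ho : IsOpen Ω) (hoΩ : o ∈ Ω) {y z : E2}
    (hy : y ∈ frontier Ω) (hz : z ∈ frontier Ω) {a b : ℝ} (ha : 0 < a) (hb : 0 < b)
    (h : a • (y - o) = b • (z - o)) : a = b ∧ y = z := by
  obtain ⟨hc, hn, hfr, -, -⟩ := radial_gauge hconv ho hoΩ
  have := congrArg (gauge ((fun v => o + v) ⁻¹' Ω)) h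
  rw [gauge_smul_of_nonneg ha.le, gauge_smul_of_nonneg hb.le, (hfr y).1 hy, (hfr z).1 hz] at this
  have hab : a = b := by simpa using this
  subst hab
  exact ⟨rfl, sub_left_injective (smul_right_injective E2 ha.ne' h)⟩

lemma radial_mem_extDom (hconv : Convex ℝ Ω) (ho : IsOpen Ω) (hoΩ : o ∈ Ω) {y : E2}
    (hy : y ∈ frontier Ω) {a : ℝ} (ha : 1 < a) : o + a • (y - o) ∈ extDom Ω := by
  obtain ⟨hc, hn, hfr, hcl, -⟩ := radial_gauge hconv ho hoΩ
  intro hmem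
  rw [hcl, add_sub_cancel_left, gauge_smul_of_nonneg (by linarith), (hfr y).1 hy, smul_eq_mul,
    mul_one] at hmem
  linarith

end radial

namespace IsArcBoundary

variable {Ω : Set E2} {β : ℝ → E2} {L : ℝ}

lemma volume_le (h : IsArcBoundary Ω β L) (hconv : Convex ℝ Ω) (ho : IsOpen Ω)
    (hb : IsBounded Ω) {o : E2} (hoΩ : o ∈ Ω) {σ : ℝ} (hσ2 : σ ^ 2 = 1)
    (hσ : ∀ s, ∀ y ∈ Ω, σ * crossE (y - β s) (deriv β s) < 0) :
    volume Ω ≤ ENNReal.ofReal ((∫ s in (0 : ℝ)..1, σ * crossE (β s - o) (deriv β s)) / 2) := by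
  set D : ℝ → ℝ := fun s => σ * crossE (β s - o) (deriv β s) with hD
  have hβc := h.smooth.continuous
  have hDc : Continuous D := continuous_const.mul
    (continuous_crossE (hβc.sub continuous_const) h.continuous_deriv)
  have hσabs : |σ| = 1 := by rw [← sq_eq_sq₀ (abs_nonneg _) zero_le_one, sq_abs, hσ2, one_pow]
  have hDpos : ∀ s, 0 < D s := fun s => by
    have := hσ s o hoΩ
    simp only [hD, crossE, PiLp.sub_apply] at this ⊢
    linarith
  have hDabs : ∀ s, |crossE (β s - o) (deriv β s)| = D s := fun s => by
    rw [← one_mul |crossE _ _|, ← hσabs, ← abs_mul, abs_of_pos (hDpos s)]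
  have hi : IntegrableOn (fun r : ℝ => r) (Ico 0 1) :=
    (continuous_id.integrableOn_Icc).mono_set Ico_subset_Icc_self
  calc volume Ω ≤ volume (ruled (fun _ => o) (fun s => β s - o) ''
          (Ico (0 : ℝ) 1 ×ˢ Ico (0 : ℝ) 1)) := by
        refine measure_mono fun x hx => ?_
        by_cases hxo : x = o
        · exact ⟨(0, 0), by simp, by simp [ruled, hxo]⟩
        · obtain ⟨y, hy, r, hr, hxy⟩ := exists_radial hconv ho hb hoΩ hx hxo
          obtain ⟨s, hs, rfl⟩ := h.exists_param hy
          exact ⟨(s, r), ⟨hs, hr.1.le, hr.2⟩, hxy.symm⟩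
    _ ≤ ∫⁻ z in Ico (0 : ℝ) 1 ×ˢ Ico (0 : ℝ) 1,
          ENNReal.ofReal |crossE ((0 : E2) + z.2 • deriv β z.1) (β z.1 - o)| :=
        volume_image_ruled_le (fun s => hasDerivAt_const s o)
          (fun s => (h.hasDerivAt s).sub_const o) (measurableSet_Ico.prod measurableSet_Ico)
    _ = ∫⁻ z in Ico (0 : ℝ) 1 ×ˢ Ico (0 : ℝ) 1,
          ENNReal.ofReal (D z.1) * ENNReal.ofReal z.2 := by
        refine setLIntegral_congr_fun (measurableSet_Ico.prod measurableSet_Ico) fun z hz => ?_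
        have e : crossE ((0 : E2) + z.2 • deriv β z.1) (β z.1 - o) =
            -(crossE (β z.1 - o) (deriv β z.1) * z.2) := by
          simp only [crossE, zero_add, PiLp.smul_apply, smul_eq_mul]; ring
        rw [e, abs_neg, abs_mul, hDabs, abs_of_nonneg hz.2.1, ENNReal.ofReal_mul (hDpos _).le]
    _ = (∫⁻ s in Ico (0 : ℝ) 1, ENNReal.ofReal (D s)) *
          ∫⁻ r in Ico (0 : ℝ) 1, ENNReal.ofReal r := by
        rw [Measure.volume_eq_prod, ← Measure.prod_restrict]
        exact lintegral_prod_mul (f := fun s => ENNReal.ofReal (D s))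
          (g := fun r => ENNReal.ofReal r) (by fun_prop) (by fun_prop)
    _ = ENNReal.ofReal ((∫ s in (0 : ℝ)..1, D s) / 2) := by
        rw [← ofReal_integral_eq_lintegral_ofReal
            ((hDc.integrableOn_Icc).mono_set Ico_subset_Icc_self)
            (Eventually.of_forall fun s => (hDpos s).le),
          ← ofReal_integral_eq_lintegral_ofReal hi
            ((ae_restrict_iff' measurableSet_Ico).2 (Eventually.of_forall fun r hr => hr.1)),
          ← integral_Ioc_eq_integral_Ioo.trans integral_Ico_eq_integral_Ioo.symm,
          ← integral_Ioc_eq_integral_Ioo.trans integral_Ico_eq_integral_Ioo.symm,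
          ← intervalIntegral.integral_of_le zero_le_one,
          ← intervalIntegral.integral_of_le zero_le_one, integral_id,
          ← ENNReal.ofReal_mul (intervalIntegral.integral_nonneg zero_le_one
            fun s _ => (hDpos s).le)]
        norm_num [div_eq_mul_inv]

/-- The strict isoperimetric inequality. -/
lemma two_pi_mul_lt (h : IsArcBoundary Ω β L) (hconv : Convex ℝ Ω) (ho : IsOpen Ω)
    (hb : IsBounded Ω) (hne : Ω.Nonempty) (hnd : ¬ ∃ (x : E2) (r : ℝ), Ω = ball x r)
    {R : ℝ} (hR : 0 < R) (harea : volume Ω = ENNReal.ofReal (π * R ^ 2)) :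
    2 * π * R < L := by
  obtain ⟨o, hoΩ⟩ := hne
  obtain ⟨σ, hσ2, hσ⟩ := h.exists_orientation hconv ho hoΩ
  have hL := h.pos
  have hπ := pi_pos
  by_contra! hle
  have hβc := h.smooth.continuous
  have hβ'c := h.continuous_deriv
  set m : Fin 2 → ℝ := fun i => ∫ s in (0 : ℝ)..1, β s i with hm
  set f : Fin 2 → ℝ → ℝ := fun i s => β s i - m i with hf
  set f' : Fin 2 → ℝ → ℝ := fun i s => deriv β s i with hf'
  have hfd : ∀ i s, HasDerivAt (f i) (f' i s) s := fun i s =>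
    (hasDerivAt_coord (h.hasDerivAt s) i).sub_const (m i)
  have hcoordc : ∀ i, Continuous fun s => β s i := fun i => by fun_prop
  have hfc : ∀ i, Continuous (f i) := fun i => (hcoordc i).sub continuous_const
  have hf'c : ∀ i, Continuous (f' i) := fun i => by simp only [hf']; fun_prop
  have hβ01 : β 1 = β 0 := by simpa using h.periodic 0
  have hfper : ∀ i, f i 1 = f i 0 := fun i => by simp only [hf, hβ01]
  have hfmean : ∀ i, ∫ s in (0 : ℝ)..1, f i s = 0 := fun i => by
    simp only [hf]
    rw [intervalIntegral.integral_sub ((hcoordc i).intervalIntegrable _ _)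
      (continuous_const.intervalIntegrable _ _)]
    simp [hm]
  have hf'mean : ∀ i, ∫ s in (0 : ℝ)..1, f' i s = 0 := fun i => by
    rw [intervalIntegral.integral_eq_sub_of_hasDerivAt (fun s _ => hfd i s)
      ((hf'c i).intervalIntegrable _ _), hfper, sub_self]
  have hW := fun i => wirtinger (hfd i) (hf'c i) (hfper i) (hfmean i)
  have hspeed : (∫ s in (0 : ℝ)..1, f' 0 s ^ 2) + ∫ s in (0 : ℝ)..1, f' 1 s ^ 2 = L ^ 2 := by
    have j : ∀ i, IntervalIntegrable (fun s => f' i s ^ 2) volume 0 1 := fun i =>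
      ((hf'c i).pow 2).intervalIntegrable _ _
    rw [← intervalIntegral.integral_add (j 0) (j 1)]
    simp only [hf', h.speed_sq]
    simp
  set C : ℝ := ∫ s in (0 : ℝ)..1, (f 0 s * f' 1 s - f 1 s * f' 0 s) with hC
  have hcross : ∫ s in (0 : ℝ)..1, σ * crossE (β s - o) (deriv β s) = σ * C := by
    have e : ∀ s, σ * crossE (β s - o) (deriv β s) = σ * (f 0 s * f' 1 s - f 1 s * f' 0 s) +
        (σ * (m 0 - o 0) * f' 1 s - σ * (m 1 - o 1) * f' 0 s) := fun s => by
      simp only [hf, hf', crossE, PiLp.sub_apply]; ring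
    simp only [e]
    have i1 : IntervalIntegrable (fun s => σ * (f 0 s * f' 1 s - f 1 s * f' 0 s)) volume 0 1 :=
      Continuous.intervalIntegrable (continuous_const.mul
        (((hfc 0).mul (hf'c 1)).sub ((hfc 1).mul (hf'c 0)))) _ _
    have i2 : ∀ (c : ℝ) i, IntervalIntegrable (fun s => c * f' i s) volume 0 1 := fun c i =>
      (continuous_const.mul (hf'c i)).intervalIntegrable _ _
    rw [intervalIntegral.integral_add i1 ((i2 _ 1).sub (i2 _ 0)),
      intervalIntegral.integral_sub (i2 _ 1) (i2 _ 0)]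
    simp only [intervalIntegral.integral_const_mul, hf'mean]
    simp [hC]
  have hA : π * R ^ 2 ≤ σ * C / 2 := by
    have h1 := h.volume_le hconv ho hb hoΩ hσ2 hσ
    rw [harea, hcross] at h1
    by_contra! hlt
    exact absurd ((ENNReal.ofReal_lt_ofReal_iff (by positivity)).2 hlt) (not_lt.2 h1)
  set G : ℝ → ℝ := fun s =>
    (f' 0 s + 2 * π * σ * f 1 s) ^ 2 + (f' 1 s - 2 * π * σ * f 0 s) ^ 2 with hG
  have hGc : Continuous G :=
    (((hf'c 0).add (continuous_const.mul (hfc 1))).pow 2).add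
      (((hf'c 1).sub (continuous_const.mul (hfc 0))).pow 2)
  have hGint : ∫ s in (0 : ℝ)..1, G s = L ^ 2 +
      (4 * π ^ 2 * (∫ s in (0 : ℝ)..1, f 0 s ^ 2) + 4 * π ^ 2 * ∫ s in (0 : ℝ)..1, f 1 s ^ 2) -
      4 * π * (σ * C) := by
    have e : ∀ s, G s = (f' 0 s ^ 2 + f' 1 s ^ 2) +
        (4 * π ^ 2 * f 0 s ^ 2 + 4 * π ^ 2 * f 1 s ^ 2) -
        (4 * π * σ) * (f 0 s * f' 1 s - f 1 s * f' 0 s) := fun s => by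
      simp only [hG]
      linear_combination (4 * π ^ 2 * (f 0 s ^ 2 + f 1 s ^ 2)) * hσ2
    have j1 : ∀ i, IntervalIntegrable (fun s => f' i s ^ 2) volume 0 1 := fun i =>
      ((hf'c i).pow 2).intervalIntegrable _ _
    have j2 : ∀ i, IntervalIntegrable (fun s => 4 * π ^ 2 * f i s ^ 2) volume 0 1 := fun i =>
      (continuous_const.mul ((hfc i).pow 2)).intervalIntegrable _ _
    have j3 : IntervalIntegrable
        (fun s => (4 * π * σ) * (f 0 s * f' 1 s - f 1 s * f' 0 s)) volume 0 1 :=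
      Continuous.intervalIntegrable (continuous_const.mul
        (((hfc 0).mul (hf'c 1)).sub ((hfc 1).mul (hf'c 0)))) _ _
    simp only [e]
    rw [intervalIntegral.integral_sub (((j1 0).add (j1 1)).add ((j2 0).add (j2 1))) j3,
      intervalIntegral.integral_add ((j1 0).add (j1 1)) ((j2 0).add (j2 1)),
      intervalIntegral.integral_add (j1 0) (j1 1), intervalIntegral.integral_add (j2 0) (j2 1),
      hspeed]
    simp only [intervalIntegral.integral_const_mul]
    rw [hC]; ring
  have hGle : ∫ s in (0 : ℝ)..1, G s ≤ 0 := by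
    rw [hGint]
    have h0 := hW 0
    have h1 := hW 1
    have h2 : L ^ 2 ≤ (2 * π * R) ^ 2 := pow_le_pow_left₀ hL.le hle 2
    nlinarith
  have hGzero : ∀ s ∈ Icc (0 : ℝ) 1, G s = 0 := fun s hs => by
    by_contra hne
    have hpos : 0 < G s := lt_of_le_of_ne (by positivity) (Ne.symm hne)
    have := intervalIntegral.integral_pos zero_lt_one hGc.continuousOn
      (fun x _ => by positivity) ⟨s, hs, hpos⟩
    linarith
  refine hnd ⟨!₂[m 0, m 1], L / (2 * π), eq_ball_of_frontier_subset_sphere ⟨o, hoΩ⟩ ho hb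
    (by positivity) fun y hy => ?_⟩
  obtain ⟨s, hs, rfl⟩ := h.exists_param hy
  have hz := hGzero s (Ico_subset_Icc_self hs)
  have h0 : f' 0 s = -(2 * π * σ * f 1 s) := by
    have : f' 0 s + 2 * π * σ * f 1 s = 0 := by
      rw [← sq_eq_zero_iff]
      nlinarith [sq_nonneg (f' 0 s + 2 * π * σ * f 1 s), sq_nonneg (f' 1 s - 2 * π * σ * f 0 s)]
    linarith
  have h1 : f' 1 s = 2 * π * σ * f 0 s := by
    have : f' 1 s - 2 * π * σ * f 0 s = 0 := by
      rw [← sq_eq_zero_iff]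
      nlinarith [sq_nonneg (f' 0 s + 2 * π * σ * f 1 s), sq_nonneg (f' 1 s - 2 * π * σ * f 0 s)]
    linarith
  have hsp : f' 0 s ^ 2 + f' 1 s ^ 2 = L ^ 2 := h.speed_sq s
  rw [h0, h1] at hsp
  rw [mem_sphere, dist_eq_norm, ← sq_eq_sq₀ (norm_nonneg _) (by positivity), normSq_E2]
  simp only [PiLp.sub_apply, Matrix.cons_val_zero, Matrix.cons_val_one]
  change f 0 s ^ 2 + f 1 s ^ 2 = _
  rw [div_pow, eq_div_iff (by positivity), ← hsp]
  linear_combination (-(4 * π ^ 2 * (f 0 s ^ 2 + f 1 s ^ 2))) * hσ2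

end IsArcBoundary

lemma hausdorff_restrict_le {β : ℝ → E2} {K : NNReal} (hβ : LipschitzWith K β) {F : Set E2}
    (hF : F ⊆ β '' Ico 0 1) :
    (μH[1] : Measure E2).restrict F ≤ (K : ENNReal) • (volume.restrict (Ico 0 1)).map β := by
  have hm : Measurable β := hβ.continuous.measurable
  refine Measure.le_iff.2 fun A hA => ?_
  rw [Measure.restrict_apply hA, Measure.smul_apply, Measure.map_apply hm hA,
    Measure.restrict_apply (hm hA), smul_eq_mul]
  calc μH[1] (A ∩ F) ≤ μH[1] (β '' (β ⁻¹' A ∩ Ico 0 1)) := by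
        refine measure_mono fun x hx => ?_
        obtain ⟨s, hs, rfl⟩ := hF hx.2
        exact ⟨s, ⟨hx.1, hs⟩, rfl⟩
    _ ≤ (K : ENNReal) ^ (1 : ℝ) * μH[1] (β ⁻¹' A ∩ Ico 0 1) :=
        (hβ.lipschitzOnWith).hausdorffMeasure_image_le zero_le_one
    _ = _ := by rw [ENNReal.rpow_one, hausdorffMeasure_real]

lemma lintegral_hausdorff_le {β : ℝ → E2} {K : NNReal} (hβ : LipschitzWith K β) {F : Set E2}
    (hF : F ⊆ β '' Ico 0 1) {g : E2 → ENNReal} (hg : Measurable g) :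
    ∫⁻ x in F, g x ∂μH[1] ≤ K * ∫⁻ s in Ico (0 : ℝ) 1, g (β s) := by
  refine (lintegral_mono' (hausdorff_restrict_le hβ hF) le_rfl).trans ?_
  rw [lintegral_smul_measure, lintegral_map hg hβ.continuous.measurable, smul_eq_mul]

lemma hausdorff_lt_top {β : ℝ → E2} {K : NNReal} (hβ : LipschitzWith K β) {F : Set E2}
    (hF : F ⊆ β '' Ico 0 1) : μH[1] F < ⊤ := by
  refine (measure_mono hF).trans_lt
    (((hβ.lipschitzOnWith).hausdorffMeasure_image_le zero_le_one).trans_lt ?_)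
  rw [hausdorffMeasure_real]
  simp

lemma dist_le_hausdorff_image {β : ℝ → E2} (hβ : Continuous β) {a b : ℝ} (hab : a ≤ b) :
    ENNReal.ofReal (dist (β b) (β a)) ≤ μH[1] (β '' Ico a b) := by
  have h1 : Ico 0 (dist (β b) (β a)) ⊆ (fun x => dist x (β a)) '' (β '' Ico a b) := by
    have := intermediate_value_Ico hab (f := fun s => dist (β s) (β a)) (by fun_prop)
    rw [dist_self] at this
    rwa [image_image]
  calc ENNReal.ofReal (dist (β b) (β a)) = μH[1] (Ico 0 (dist (β b) (β a))) := by
        rw [hausdorffMeasure_real, Real.volume_Ico, sub_zero]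
    _ ≤ μH[1] ((fun x => dist x (β a)) '' (β '' Ico a b)) := measure_mono h1
    _ ≤ _ := by
        have := ((LipschitzWith.dist_left (β a)).lipschitzOnWith
          (s := β '' Ico a b)).hausdorffMeasure_image_le (d := 1) zero_le_one
        simpa using this

namespace IsArcBoundary

variable {Ω : Set E2} {β : ℝ → E2} {L : ℝ}

lemma lipschitz (h : IsArcBoundary Ω β L) : LipschitzWith L.toNNReal β :=
  lipschitzWith_of_nnnorm_deriv_le (fun s => (h.hasDerivAt s).differentiableAt) fun s => by
    rw [← NNReal.coe_le_coe, coe_nnnorm, h.speed, Real.coe_toNNReal _ h.pos.le]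

lemma frontier_subset (h : IsArcBoundary Ω β L) : frontier Ω ⊆ β '' Ico 0 1 := fun _ hy =>
  h.exists_param hy

lemma le_hausdorff_frontier (h : IsArcBoundary Ω β L) :
    ENNReal.ofReal L ≤ μH[1] (frontier Ω) := by
  refine ENNReal.le_of_forall_pos_le_add fun ε hε _ => ?_
  have hβc := h.smooth.continuous
  obtain ⟨δ, hδ, hδε⟩ := Metric.uniformContinuousOn_iff.1
    (isCompact_Icc.uniformContinuousOn_of_continuous (s := Icc (0 : ℝ) 1)
      h.continuous_deriv.continuousOn) ε (by exact_mod_cast hε)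
  obtain ⟨n, hn⟩ := exists_nat_one_div_lt hδ
  set N : ℝ := n + 1 with hN
  have hN0 : 0 < N := by positivity
  set S : ℕ → Set E2 := fun i => β '' Ico (i / N) ((i + 1) / N) with hS
  have hsub : ∀ i ∈ Finset.range (n + 1), Icc ((i : ℝ) / N) ((i + 1) / N) ⊆ Icc 0 1 :=
      fun i hi => by
    have : (i : ℝ) + 1 ≤ N := by rw [hN]; exact_mod_cast Finset.mem_range.1 hi
    exact Icc_subset_Icc (by positivity) ((div_le_one hN0).2 this)
  have hsub' : ∀ i ∈ Finset.range (n + 1), Ico ((i : ℝ) / N) ((i + 1) / N) ⊆ Ico 0 1 :=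
      fun i hi => by
    have : (i : ℝ) + 1 ≤ N := by rw [hN]; exact_mod_cast Finset.mem_range.1 hi
    exact Ico_subset_Ico (by positivity) ((div_le_one hN0).2 this)
  have hchord : ∀ i ∈ Finset.range (n + 1), ENNReal.ofReal ((L - ε) / N) ≤ μH[1] (S i) := by
    intro i hi
    have hab : (i : ℝ) / N ≤ (i + 1) / N := by gcongr; linarith
    refine le_trans (ENNReal.ofReal_le_ofReal ?_) (dist_le_hausdorff_image hβc hab)
    have hlen : ((i : ℝ) + 1) / N - i / N = 1 / N := by ring
    have key := Convex.norm_image_sub_le_of_norm_hasDerivWithin_le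
      (f := fun s => β s - s • deriv β (i / N)) (f' := fun s => deriv β s - deriv β (i / N))
      (C := ε) (s := Icc ((i : ℝ) / N) ((i + 1) / N)) (x := i / N) (y := (i + 1) / N)
      (fun s _ => ?_) (fun s hs => ?_) (convex_Icc _ _) (left_mem_Icc.2 hab) (right_mem_Icc.2 hab)
    · have e : β ((i + 1) / N) - ((i + 1) / N : ℝ) • deriv β (i / N) -
          (β (i / N) - (i / N : ℝ) • deriv β (i / N)) =
          (β ((i + 1) / N) - β (i / N)) - (1 / N : ℝ) • deriv β (i / N) := by
        rw [← hlen, sub_smul]; abel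
      rw [hlen] at key
      simp only [e] at key
      have h2 := norm_sub_norm_le ((1 / N : ℝ) • deriv β (i / N)) (β ((i + 1) / N) - β (i / N))
      rw [norm_sub_rev ((1 / N : ℝ) • deriv β (i / N)), norm_smul, h.speed,
        Real.norm_of_nonneg (by positivity)] at h2
      rw [Real.norm_of_nonneg (show (0 : ℝ) ≤ 1 / N by positivity)] at key
      rw [dist_eq_norm]
      have : (L - ε) / N = 1 / N * L - ε * (1 / N) := by ring
      linarith
    · exact ((h.hasDerivAt s).sub ((hasDerivAt_id s).smul_const _) |>.congr_deriv
        (by simp)).hasDerivWithinAt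
    · rw [← dist_eq_norm]
      refine (hδε s (hsub i hi hs) _ (hsub i hi (left_mem_Icc.2 hab)) ?_).le
      rw [Real.dist_eq, abs_of_nonneg (by linarith [hs.1])]
      have := hs.2
      linarith
  have hdisj : (Finset.range (n + 1) : Set ℕ).PairwiseDisjoint S := by
    intro i hi j hj hij
    refine disjoint_left.2 ?_
    rintro _ ⟨s, hs, rfl⟩ ⟨t, ht, hts⟩
    have hst := h.inj (hsub' j hj ht) (hsub' i hi hs) hts
    subst hst
    refine hij ?_
    have a1 := (div_le_iff₀ hN0).1 hs.1
    have a2 := (lt_div_iff₀ hN0).1 hs.2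
    have a3 := (div_le_iff₀ hN0).1 ht.1
    have a4 := (lt_div_iff₀ hN0).1 ht.2
    have b1 : (i : ℝ) < j + 1 := a1.trans_lt a4
    have b2 : (j : ℝ) < i + 1 := a3.trans_lt a2
    have c1 : i < j + 1 := by exact_mod_cast b1
    have c2 : j < i + 1 := by exact_mod_cast b2
    omega
  have hmeas : ∀ i ∈ Finset.range (n + 1), MeasurableSet (S i) := fun i hi =>
    measurableSet_Ico.image_of_continuousOn_injOn hβc.continuousOn (h.inj.mono (hsub' i hi))
  have hle : ENNReal.ofReal (L - ε) ≤ μH[1] (frontier Ω) := by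
    calc ENNReal.ofReal (L - ε) = ∑ i ∈ Finset.range (n + 1), ENNReal.ofReal ((L - ε) / N) := by
          rw [Finset.sum_const, Finset.card_range, nsmul_eq_mul, ← ENNReal.ofReal_natCast,
            ← ENNReal.ofReal_mul (by positivity)]
          push_cast
          rw [← hN, mul_div_cancel₀ _ hN0.ne']
      _ ≤ ∑ i ∈ Finset.range (n + 1), μH[1] (S i) := Finset.sum_le_sum hchord
      _ = μH[1] (⋃ i ∈ Finset.range (n + 1), S i) := (measure_biUnion_finset hdisj hmeas).symm
      _ ≤ _ := measure_mono (iUnion₂_subset fun i hi => by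
          rintro _ ⟨s, _, rfl⟩
          exact h.mem_frontier s)
  calc ENNReal.ofReal L = ENNReal.ofReal ((L - ε) + ε) := by rw [sub_add_cancel]
    _ ≤ ENNReal.ofReal (L - ε) + ENNReal.ofReal ε := ENNReal.ofReal_add_le
    _ ≤ _ := by
        rw [ENNReal.ofReal_coe_nnreal]
        gcongr

end IsArcBoundary

lemma hasCompactSupport_line {u : E2 → ℝ} (hu : HasCompactSupport u) (p : E2) {q : E2}
    (hq : q ≠ 0) : HasCompactSupport fun t : ℝ => u (p + t • q) := by
  obtain ⟨r, hr⟩ := hu.isCompact.isBounded.subset_closedBall p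
  refine HasCompactSupport.intro (isCompact_Icc (a := -(r / ‖q‖)) (b := r / ‖q‖)) fun t ht => ?_
  by_contra hne
  have h1 := hr (subset_tsupport u hne)
  rw [mem_closedBall, dist_eq_norm, add_sub_cancel_left, norm_smul, Real.norm_eq_abs,
    ← le_div_iff₀ (norm_pos_iff.2 hq)] at h1
  exact ht (abs_le.1 h1)

lemma hasDerivAt_line {u : E2 → ℝ} (hu : ContDiff ℝ (⊤ : ℕ∞) u) (p q : E2) (t : ℝ) :
    HasDerivAt (fun t : ℝ => u (p + t • q)) (fderiv ℝ u (p + t • q) q) t := by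
  have h1 : HasDerivAt (fun t : ℝ => p + t • q) q t := by
    simpa using ((hasDerivAt_id t).smul_const q).const_add p
  exact ((hu.differentiable (by simp)).differentiableAt.hasFDerivAt).comp_hasDerivAt t h1

lemma contDiff_line {u : E2 → ℝ} (hu : ContDiff ℝ (⊤ : ℕ∞) u) (p q : E2) :
    ContDiff ℝ (⊤ : ℕ∞) fun t : ℝ => u (p + t • q) :=
  hu.comp (contDiff_const.add (contDiff_id.smul contDiff_const))

lemma sq_le_lintegral_Ioi {f : ℝ → ℝ} (hf : ContDiff ℝ 1 f) (hc : HasCompactSupport f) (a : ℝ) :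
    ENNReal.ofReal (f a ^ 2) ≤ ∫⁻ t in Ioi a, ENNReal.ofReal (2 * |f t| * |deriv f t|) := by
  have hsq : HasCompactSupport fun t => f t ^ 2 := hc.comp_left (g := fun x : ℝ => x ^ 2) (by simp)
  have h1 := HasCompactSupport.integral_Ioi_deriv_eq (hf.pow 2) hsq a
  have hd : ∀ t, deriv (fun t => f t ^ 2) t = 2 * f t * deriv f t := fun t => by
    have : deriv (f ^ 2) t = 2 * f t * deriv f t := by
      simpa using (((hf.differentiable one_ne_zero) t).hasDerivAt.pow 2).deriv
    exact this
  have hcont : Continuous fun t => 2 * |f t| * |deriv f t| :=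
    (continuous_const.mul hf.continuous.abs).mul (hf.continuous_deriv le_rfl).abs
  have hsupp : HasCompactSupport fun t => 2 * |f t| * |deriv f t| :=
    (hc.comp_left (g := fun x : ℝ => 2 * |x|) (by simp)).mul_right
  rw [← ofReal_integral_eq_lintegral_ofReal
    (hcont.integrable_of_hasCompactSupport hsupp).integrableOn
    (Eventually.of_forall fun t => by positivity)]
  refine ENNReal.ofReal_le_ofReal ?_
  have h2 : f a ^ 2 = -∫ t in Ioi a, deriv (fun t => f t ^ 2) t := by rw [h1]; simp
  rw [h2]
  refine (neg_le_abs _).trans ((abs_integral_le_integral_abs).trans_eq ?_)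
  refine setIntegral_congr_fun measurableSet_Ioi fun t _ => ?_
  simp only [hd, abs_mul, abs_two]

/-- The Dirichlet energy on the exterior. -/
def dirichletE (Ω : Set E2) (u : E2 → ℝ) : ℝ := ∫ x in extDom Ω, ‖fderiv ℝ u x‖ ^ 2

/-- The boundary energy. -/
def boundaryE (Ω : Set E2) (u : E2 → ℝ) : ℝ := ∫ x in frontier Ω, (u x) ^ 2 ∂(μH[1])

/-- The mass on the exterior. -/
def massE (Ω : Set E2) (u : E2 → ℝ) : ℝ := ∫ x in extDom Ω, (u x) ^ 2

section Test

variable {u : E2 → ℝ}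

lemma continuous_grad_sq (hu : ContDiff ℝ (⊤ : ℕ∞) u) :
    Continuous fun x => ‖fderiv ℝ u x‖ ^ 2 :=
  ((hu.continuous_fderiv (by simp)).norm).pow 2

lemma integrable_grad_sq (hu : ContDiff ℝ (⊤ : ℕ∞) u) (hc : HasCompactSupport u) :
    Integrable fun x => ‖fderiv ℝ u x‖ ^ 2 :=
  (continuous_grad_sq hu).integrable_of_hasCompactSupport
    ((hc.fderiv ℝ).comp_left (g := fun y => ‖y‖ ^ 2) (by simp))

lemma continuous_test_sq (hu : ContDiff ℝ (⊤ : ℕ∞) u) : Continuous fun x => u x ^ 2 := by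
  have := hu.continuous
  fun_prop

lemma hasCompactSupport_test_sq (hc : HasCompactSupport u) :
    HasCompactSupport fun x => u x ^ 2 := by
  have := hc.comp_left (g := fun y : ℝ => y ^ 2) (by simp)
  exact this

lemma integrable_test_sq (hu : ContDiff ℝ (⊤ : ℕ∞) u) (hc : HasCompactSupport u) :
    Integrable fun x => u x ^ 2 :=
  (continuous_test_sq hu).integrable_of_hasCompactSupport (hasCompactSupport_test_sq hc)

lemma ofReal_boundaryE (hu : ContDiff ℝ (⊤ : ℕ∞) u) (hc : HasCompactSupport u) {Ω : Set E2}
    (hΩ : μH[1] (frontier Ω) < ⊤) :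
    ENNReal.ofReal (boundaryE Ω u) = ∫⁻ x in frontier Ω, ENNReal.ofReal (u x ^ 2) ∂μH[1] := by
  have : IsFiniteMeasure ((μH[1] : Measure E2).restrict (frontier Ω)) :=
    isFiniteMeasure_restrict.2 hΩ.ne
  exact ofReal_integral_eq_lintegral_ofReal
    ((continuous_test_sq hu).integrable_of_hasCompactSupport (hasCompactSupport_test_sq hc))
    (Eventually.of_forall fun _ => by positivity)

lemma dirichletE_nonneg (Ω : Set E2) (u : E2 → ℝ) : 0 ≤ dirichletE Ω u :=
  integral_nonneg fun _ => by positivity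

lemma boundaryE_nonneg (Ω : Set E2) (u : E2 → ℝ) : 0 ≤ boundaryE Ω u :=
  integral_nonneg fun _ => by positivity

lemma massE_nonneg (Ω : Set E2) (u : E2 → ℝ) : 0 ≤ massE Ω u :=
  integral_nonneg fun _ => by positivity

lemma massE_pos (hu : ContDiff ℝ (⊤ : ℕ∞) u) (hc : HasCompactSupport u) {Ω : Set E2}
    (hne : ∃ x ∈ extDom Ω, u x ≠ 0) : 0 < massE Ω u := by
  obtain ⟨x, hx, hux⟩ := hne
  have ho : IsOpen (extDom Ω) := isClosed_closure.isOpen_compl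
  rw [massE, integral_pos_iff_support_of_nonneg (fun _ => by positivity)
    (integrable_test_sq hu hc).integrableOn, Measure.restrict_apply' ho.measurableSet]
  have hop : IsOpen (Function.support (fun x => u x ^ 2) ∩ extDom Ω) :=
    ((continuous_test_sq hu).isOpen_support).inter ho
  exact hop.measure_pos _ ⟨x, by simpa using hux, hx⟩

end Test

namespace IsArcBoundary

variable {Ω : Set E2} {β : ℝ → E2} {L : ℝ}

lemma boundaryE_le (h : IsArcBoundary Ω β L) (hconv : Convex ℝ Ω) (ho : IsOpen Ω)
    (hne : Ω.Nonempty) : ∃ K > 0, ∃ M > 0, ∀ ε > 0, ∀ u : E2 → ℝ, ContDiff ℝ (⊤ : ℕ∞) u →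
      HasCompactSupport u →
      boundaryE Ω u ≤ K * (ε * dirichletE Ω u + M / ε * massE Ω u) := by
  obtain ⟨o, hoΩ⟩ := hne
  obtain ⟨σ, hσ2, hσ⟩ := h.exists_orientation hconv ho hoΩ
  have hL := h.pos
  have hβc := h.smooth.continuous
  have hσabs : |σ| = 1 := by rw [← sq_eq_sq₀ (abs_nonneg _) zero_le_one, sq_abs, hσ2, one_pow]
  set D : ℝ → ℝ := fun s => |crossE (β s - o) (deriv β s)| with hD
  have hDc : Continuous D :=
    (continuous_crossE (hβc.sub continuous_const) h.continuous_deriv).abs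
  have hDpos : ∀ s, 0 < D s := fun s => by
    refine abs_pos.2 fun h0 => ?_
    have := hσ s o hoΩ
    simp only [crossE, PiLp.sub_apply] at this h0
    have e : (o 0 - β s 0) * deriv β s 1 - (o 1 - β s 1) * deriv β s 0 = 0 := by linarith
    rw [e, mul_zero] at this
    exact lt_irrefl _ this
  obtain ⟨s₀, -, hs₀⟩ := isCompact_Icc.exists_isMinOn (nonempty_Icc.2 (zero_le_one (α := ℝ)))
    hDc.continuousOn
  obtain ⟨s₁, -, hs₁⟩ := isCompact_Icc.exists_isMaxOn (nonempty_Icc.2 (zero_le_one (α := ℝ)))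
    (show ContinuousOn (fun s => ‖β s - o‖ ^ 2) (Icc 0 1) by fun_prop)
  have hb0 : ∀ s, β s - o ≠ 0 := fun s h0 => by
    have := hDpos s
    rw [hD] at this
    simp only [h0] at this
    simp [crossE] at this
  set c := D s₀ with hc
  have hc0 : 0 < c := hDpos _
  refine ⟨L / c, div_pos hL hc0, ‖β s₁ - o‖ ^ 2, by
    have := norm_pos_iff.2 (hb0 s₁); positivity, fun ε hε u hu hcu => ?_⟩
  set M := ‖β s₁ - o‖ ^ 2 with hM
  have hMpos : 0 < M := by have := norm_pos_iff.2 (hb0 s₁); positivity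
  set G : E2 → ENNReal := fun x => ENNReal.ofReal (ε * ‖fderiv ℝ u x‖ ^ 2 + M / ε * u x ^ 2) with hG
  have hGc : Continuous fun x => ε * ‖fderiv ℝ u x‖ ^ 2 + M / ε * u x ^ 2 :=
    (continuous_const.mul (continuous_grad_sq hu)).add
      (continuous_const.mul (continuous_test_sq hu))
  have hGm : Measurable G := hGc.measurable.ennreal_ofReal
  set p : ℝ → E2 := fun _ => o
  set q : ℝ → E2 := fun s => β s - o
  have hcontr : Continuous (ruled p q) := by
    unfold ruled
    have : Continuous q := hβc.sub continuous_const
    exact continuous_const.add (continuous_snd.smul (this.comp continuous_fst))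
  have hmS : MeasurableSet (Ico (0 : ℝ) 1 ×ˢ Ioi (1 : ℝ)) :=
    measurableSet_Ico.prod measurableSet_Ioi
  have hslice : ∀ s ∈ Icc (0 : ℝ) 1,
      ENNReal.ofReal (u (β s) ^ 2) ≤ ∫⁻ r in Ioi (1 : ℝ), G (ruled p q (s, r)) := by
    intro s hs
    have h1 := sq_le_lintegral_Ioi ((contDiff_line hu o (β s - o)).of_le (by simp))
      (hasCompactSupport_line hcu o (hb0 s)) 1
    simp only [one_smul, add_sub_cancel] at h1
    refine h1.trans (lintegral_mono fun r => ENNReal.ofReal_le_ofReal ?_)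
    rw [(hasDerivAt_line hu o (β s - o) r).deriv]
    change 2 * |u (o + r • (β s - o))| * |fderiv ℝ u (o + r • (β s - o)) (β s - o)| ≤
      ε * ‖fderiv ℝ u (o + r • (β s - o))‖ ^ 2 + M / ε * u (o + r • (β s - o)) ^ 2
    set x := o + r • (β s - o)
    have h2 : |fderiv ℝ u x (β s - o)| ≤ ‖fderiv ℝ u x‖ * ‖β s - o‖ :=
      (fderiv ℝ u x).le_opNorm _
    have h3 : ‖β s - o‖ ^ 2 ≤ M := hs₁ hs
    have h4 : 2 * |u x| * |fderiv ℝ u x (β s - o)| ≤ 2 * |u x| * (‖fderiv ℝ u x‖ * ‖β s - o‖) := by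
      gcongr
    have h5 : 2 * |u x| * (‖fderiv ℝ u x‖ * ‖β s - o‖) ≤
        ε * ‖fderiv ℝ u x‖ ^ 2 + ‖β s - o‖ ^ 2 / ε * |u x| ^ 2 := by
      have := sq_nonneg (ε * ‖fderiv ℝ u x‖ - ‖β s - o‖ * |u x|)
      have e : ε * ‖fderiv ℝ u x‖ ^ 2 + ‖β s - o‖ ^ 2 / ε * |u x| ^ 2 -
          2 * |u x| * (‖fderiv ℝ u x‖ * ‖β s - o‖) =
          (ε * ‖fderiv ℝ u x‖ - ‖β s - o‖ * |u x|) ^ 2 / ε := by field_simp; ring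
      have := div_nonneg this hε.le
      linarith
    rw [sq_abs] at h5
    have h6 : ‖β s - o‖ ^ 2 / ε * u x ^ 2 ≤ M / ε * u x ^ 2 := by gcongr
    linarith
  have hinj : InjOn (ruled p q) (Ico (0 : ℝ) 1 ×ˢ Ioi (1 : ℝ)) := by
    rintro ⟨s, a⟩ ⟨hs, ha⟩ ⟨t, b⟩ ⟨ht, hb⟩ heq
    have h0a : (0 : ℝ) < a := zero_lt_one.trans ha
    have h0b : (0 : ℝ) < b := zero_lt_one.trans hb
    obtain ⟨h1, h2⟩ := radial_injective hconv ho hoΩ (h.mem_frontier s) (h.mem_frontier t) h0a h0b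
      (add_left_cancel heq)
    exact Prod.ext (h.inj hs ht h2) h1
  have harea : ENNReal.ofReal c * ∫⁻ z in Ico (0 : ℝ) 1 ×ˢ Ioi (1 : ℝ), G (ruled p q z) ≤
      ∫⁻ x in extDom Ω, G x := by
    calc _ = ∫⁻ z in Ico (0 : ℝ) 1 ×ˢ Ioi (1 : ℝ), ENNReal.ofReal c * G (ruled p q z) :=
          (lintegral_const_mul _ (hGm.comp hcontr.measurable)).symm
      _ ≤ ∫⁻ z in Ico (0 : ℝ) 1 ×ˢ Ioi (1 : ℝ),
          ENNReal.ofReal |crossE ((0 : E2) + z.2 • deriv β z.1) (q z.1)| * G (ruled p q z) := by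
          refine setLIntegral_mono' hmS fun z hz => ?_
          gcongr
          have e : crossE ((0 : E2) + z.2 • deriv β z.1) (β z.1 - o) =
              -(z.2 * crossE (β z.1 - o) (deriv β z.1)) := by
            simp only [crossE, zero_add, PiLp.smul_apply, smul_eq_mul]; ring
          change c ≤ |crossE ((0 : E2) + z.2 • deriv β z.1) (β z.1 - o)|
          have hz2 : (1 : ℝ) < z.2 := hz.2
          have h1 : c ≤ D z.1 := hs₀ (Ico_subset_Icc_self hz.1)
          rw [e, abs_neg, abs_mul, abs_of_pos (zero_lt_one.trans hz2)]
          change c ≤ z.2 * D z.1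
          nlinarith
      _ = ∫⁻ x in ruled p q '' (Ico (0 : ℝ) 1 ×ˢ Ioi (1 : ℝ)), G x :=
          (lintegral_image_ruled (fun s => hasDerivAt_const s o)
            (fun s => (h.hasDerivAt s).sub_const o) hmS hinj G).symm
      _ ≤ _ := by
          refine lintegral_mono_set ?_
          rintro _ ⟨z, hz, rfl⟩
          exact radial_mem_extDom hconv ho hoΩ (h.mem_frontier z.1) hz.2
  have hGint : ∫⁻ x in extDom Ω, G x =
      ENNReal.ofReal (ε * dirichletE Ω u + M / ε * massE Ω u) := by
    rw [dirichletE, massE, ← integral_const_mul, ← integral_const_mul, ← integral_add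
      ((integrable_grad_sq hu hcu).integrableOn.const_mul _)
      ((integrable_test_sq hu hcu).integrableOn.const_mul _)]
    refine (ofReal_integral_eq_lintegral_ofReal ?_ (Eventually.of_forall fun _ => by
      positivity)).symm
    exact ((integrable_grad_sq hu hcu).integrableOn.const_mul _).add
      ((integrable_test_sq hu hcu).integrableOn.const_mul _)
  have hfin := hausdorff_lt_top h.lipschitz h.frontier_subset
  have hD0 := dirichletE_nonneg Ω u
  have hM0 := massE_nonneg Ω u
  have hmain : ENNReal.ofReal c * ENNReal.ofReal (boundaryE Ω u) ≤
      ENNReal.ofReal L * ENNReal.ofReal (ε * dirichletE Ω u + M / ε * massE Ω u) := by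
    have h1 := lintegral_hausdorff_le h.lipschitz h.frontier_subset
      (g := fun x => ENNReal.ofReal (u x ^ 2)) (continuous_test_sq hu).measurable.ennreal_ofReal
    rw [← ofReal_boundaryE hu hcu hfin] at h1
    have h2 : ∫⁻ s in Ico (0 : ℝ) 1, ENNReal.ofReal (u (β s) ^ 2) ≤
        ∫⁻ z in Ico (0 : ℝ) 1 ×ˢ Ioi (1 : ℝ), G (ruled p q z) := by
      rw [Measure.volume_eq_prod, setLIntegral_prod (fun z => G (ruled p q z))
        (hGm.comp hcontr.measurable).aemeasurable]
      exact setLIntegral_mono' measurableSet_Ico fun s hs => hslice s (Ico_subset_Icc_self hs)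
    calc _ ≤ ENNReal.ofReal c * (ENNReal.ofReal L *
          ∫⁻ z in Ico (0 : ℝ) 1 ×ˢ Ioi (1 : ℝ), G (ruled p q z)) := by
          gcongr
          exact h1.trans (mul_le_mul_right h2 _)
      _ = ENNReal.ofReal L * (ENNReal.ofReal c *
          ∫⁻ z in Ico (0 : ℝ) 1 ×ˢ Ioi (1 : ℝ), G (ruled p q z)) := by ring
      _ ≤ _ := by
          rw [← hGint]
          gcongr
  rw [← ENNReal.ofReal_mul hc0.le, ← ENNReal.ofReal_mul hL.le,
    ENNReal.ofReal_le_ofReal_iff (by positivity)] at hmain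
  rw [div_mul_eq_mul_div, le_div_iff₀ hc0]
  linarith

end IsArcBoundary

/-- The set of Rayleigh quotients. -/
def rayleighSet (α : ℝ) (Ω : Set E2) : Set ℝ :=
  { q : ℝ | ∃ u : E2 → ℝ, ContDiff ℝ (⊤ : ℕ∞) u ∧ HasCompactSupport u ∧
    (∃ x ∈ extDom Ω, u x ≠ 0) ∧
    q = (dirichletE Ω u + α * boundaryE Ω u) / massE Ω u }

lemma robinEig_eq (α : ℝ) (Ω : Set E2) : robinEig α Ω = sInf (rayleighSet α Ω) := rfl

lemma IsArcBoundary.bddBelow_rayleighSet {Ω : Set E2} {β : ℝ → E2} {L : ℝ}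
    (h : IsArcBoundary Ω β L) (hconv : Convex ℝ Ω) (ho : IsOpen Ω) (hne : Ω.Nonempty)
    {α : ℝ} (hα : α < 0) : BddBelow (rayleighSet α Ω) := by
  obtain ⟨K, hK, M, hM, hle⟩ := h.boundaryE_le hconv ho hne
  set ε := 1 / (-α * K) with hε
  have hα' : 0 < -α := by linarith
  have hε0 : 0 < ε := by positivity
  refine ⟨-(-α * K * (M / ε)), ?_⟩
  rintro _ ⟨u, hu, hc, hnz, rfl⟩
  rw [le_div_iff₀ (massE_pos hu hc hnz)]
  have h1 := mul_le_mul_of_nonneg_left (hle ε hε0 u hu hc) hα'.le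
  have e : -α * (K * (ε * dirichletE Ω u + M / ε * massE Ω u)) =
      (-α * K * ε) * dirichletE Ω u + -α * K * (M / ε) * massE Ω u := by ring
  have e2 : -α * K * ε = 1 :=
    mul_one_div_cancel (mul_pos hα' hK).ne'
  rw [e, e2] at h1
  linarith

/-- Mollification at scale `r`, with pointwise control of the value and of the gradient. -/
lemma exists_mollification {v : E2 → ℝ} (hv : Continuous v) (hvc : HasCompactSupport v) {r : ℝ}
    (hr : 0 < r) : ∃ u : E2 → ℝ, ContDiff ℝ (⊤ : ℕ∞) u ∧ HasCompactSupport u ∧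
      (∀ x ε, (∀ y ∈ ball x r, |v y - v x| ≤ ε) → |u x - v x| ≤ ε) ∧
      (∀ x K, 0 ≤ K → (∀ a ∈ ball x (2 * r), ∀ b ∈ ball x (2 * r), |v a - v b| ≤ K * ‖a - b‖) →
        ‖fderiv ℝ u x‖ ≤ K) := by
  let ψ : ContDiffBump (0 : E2) := ⟨r / 2, r, by positivity, by linarith⟩
  set u : E2 → ℝ := convolution (ψ.normed volume) v (ContinuousLinearMap.lsmul ℝ ℝ) volume with hu
  have hdef : ∀ x, u x = ∫ t, ψ.normed volume t * v (x - t) := fun x => by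
    simp only [hu, convolution, ContinuousLinearMap.lsmul_apply, smul_eq_mul]
  have hψc : Continuous (ψ.normed volume) := ψ.continuous_normed
  have hi : ∀ x, Integrable fun t => ψ.normed volume t * v (x - t) := fun x =>
    Continuous.integrable_of_hasCompactSupport
      (hψc.mul (hv.comp (continuous_const.sub continuous_id)))
      (ψ.hasCompactSupport_normed.mul_right)
  refine ⟨u, ψ.hasCompactSupport_normed.contDiff_convolution_left _ ψ.contDiff_normed
    hv.locallyIntegrable, ψ.hasCompactSupport_normed.convolution _ hvc, fun x ε hε => ?_,
    fun x K hK hlip => ?_⟩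
  · exact ψ.dist_normed_convolution_le hv.aestronglyMeasurable hε
  · refine norm_fderiv_le_of_lip' ℝ hK ?_
    filter_upwards [ball_mem_nhds x hr] with y hy
    rw [hdef, hdef, ← integral_sub (hi y) (hi x)]
    refine (norm_integral_le_of_norm_le
      (g := fun t => ψ.normed volume t * (K * ‖y - x‖)) (ψ.integrable_normed.mul_const _)
      (Eventually.of_forall fun t => ?_)).trans_eq ?_
    · rw [← mul_sub, norm_mul, Real.norm_of_nonneg (ψ.nonneg_normed t)]
      by_cases ht : t ∈ ball (0 : E2) r
      · refine mul_le_mul_of_nonneg_left ?_ (ψ.nonneg_normed t)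
        have hy' := mem_ball_iff_norm.1 hy
        have ht' := mem_ball_zero_iff.1 ht
        have h1 := hlip (y - t) (by
          rw [mem_ball_iff_norm]
          calc ‖y - t - x‖ = ‖(y - x) - t‖ := by congr 1; abel
            _ ≤ ‖y - x‖ + ‖t‖ := norm_sub_le _ _
            _ < 2 * r := by linarith) (x - t) (by
          rw [mem_ball_iff_norm]
          calc ‖x - t - x‖ = ‖t‖ := by rw [← norm_neg t]; congr 1; abel
            _ < 2 * r := by linarith)
        rwa [sub_sub_sub_cancel_right] at h1
      · have : ψ.normed volume t = 0 := by
          by_contra h0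
          have : t ∈ Function.support (ψ.normed volume) := h0
          rw [ψ.support_normed_eq] at this
          exact ht this
        simp [this]
    · rw [integral_mul_const, ψ.integral_normed, one_mul]

/-- Uniform control of a compactly supported `C¹` function at small scales. -/
lemma exists_scale {φ : ℝ → ℝ} (hφ : ContDiff ℝ 1 φ) {T : ℝ} (hT : ∀ t, T < t → φ t = 0)
    (hc : HasCompactSupport φ) {η : ℝ} (hη : 0 < η) :
    ∃ r > 0, ∀ s e f e', (e = if s ≤ T + 1 then η else 0) → |f - s| < 2 * r → |e' - s| < 2 * r →
      |φ f - φ s| ≤ e ∧ |φ f - φ e'| ≤ (|deriv φ s| + e) * |f - e'| := by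
  have hd : Continuous (deriv φ) := hφ.continuous_deriv le_rfl
  have huc := hd.uniformContinuous_of_tendsto_cocompact
    (x := 0) (hc.deriv.is_zero_at_infty)
  have huc' := hφ.continuous.uniformContinuous_of_tendsto_cocompact
    (x := 0) (hc.is_zero_at_infty)
  obtain ⟨δ, hδ, h1⟩ := Metric.uniformContinuous_iff.1 huc η hη
  obtain ⟨δ', hδ', h2⟩ := Metric.uniformContinuous_iff.1 huc' η hη
  set r := min (min (δ / 2) (δ' / 2)) (1 / 2) with hr
  have r1 : r ≤ δ / 2 := (min_le_left _ _).trans (min_le_left _ _)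
  have r2 : r ≤ δ' / 2 := (min_le_left _ _).trans (min_le_right _ _)
  have r3 : r ≤ 1 / 2 := min_le_right _ _
  refine ⟨r, by positivity, fun s e f e' he hf he' => ?_⟩
  have hfa := abs_lt.1 hf
  have hea := abs_lt.1 he'
  by_cases hs : s ≤ T + 1
  · rw [if_pos hs] at he
    subst he
    constructor
    · have := (h2 (a := f) (b := s) (by rw [Real.dist_eq]; linarith)).le
      rwa [Real.dist_eq] at this
    · have := (convex_ball s (2 * r)).norm_image_sub_le_of_norm_deriv_le (f := φ)
        (C := |deriv φ s| + e) (fun x _ => (hφ.differentiable one_ne_zero) x) (fun x hx => ?_)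
        (show e' ∈ ball s (2 * r) by rwa [mem_ball, Real.dist_eq])
        (show f ∈ ball s (2 * r) by rwa [mem_ball, Real.dist_eq])
      · simpa only [Real.norm_eq_abs] using this
      · have h3 := h1 (a := x) (b := s) (by have := mem_ball.1 hx; linarith)
        rw [Real.dist_eq] at h3
        have := abs_sub_abs_le_abs_sub (deriv φ x) (deriv φ s)
        rw [Real.norm_eq_abs]
        linarith
  · rw [if_neg hs] at he
    subst he
    push Not at hs
    rw [hT f (by linarith), hT s (by linarith), hT e' (by linarith)]
    simp only [sub_self, abs_zero]
    exact ⟨le_rfl, by positivity⟩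

lemma hasCompactSupport_comp_infDist {Ω : Set E2} (hb : IsBounded Ω) (hne : Ω.Nonempty)
    {φ : ℝ → ℝ} {T : ℝ} (hT : ∀ t, T < t → φ t = 0) :
    HasCompactSupport fun x => φ (infDist x Ω) := by
  obtain ⟨o, -⟩ := id hne
  obtain ⟨B, hB⟩ := hb.subset_closedBall o
  refine HasCompactSupport.intro (isCompact_closedBall o (B + T)) fun x hx => hT _ ?_
  rw [mem_closedBall, not_le] at hx
  have : dist x o - B ≤ infDist x Ω := (le_infDist hne).2 fun y hy => by
    have h1 := dist_triangle x y o
    have h2 : dist y o ≤ B := hB hy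
    linarith
  linarith

namespace IsArcBoundary

variable {Ω : Set E2} {β : ℝ → E2} {L : ℝ}

lemma le_boundaryE (h : IsArcBoundary Ω β L) {u : E2 → ℝ} (hu : ContDiff ℝ (⊤ : ℕ∞) u)
    (hcu : HasCompactSupport u) {m η : ℝ} (hval : ∀ x ∈ frontier Ω, |u x - m| ≤ η) :
    L * (m ^ 2 - 2 * η * |m|) ≤ boundaryE Ω u := by
  have hL := h.pos
  have hfin := hausdorff_lt_top h.lipschitz h.frontier_subset
  by_cases hneg : m ^ 2 - 2 * η * |m| ≤ 0
  · exact (mul_nonpos_of_nonneg_of_nonpos hL.le hneg).trans (boundaryE_nonneg Ω u)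
  rw [← ENNReal.ofReal_le_ofReal_iff (boundaryE_nonneg Ω u), ofReal_boundaryE hu hcu hfin,
    ENNReal.ofReal_mul hL.le]
  calc _ ≤ μH[1] (frontier Ω) * ENNReal.ofReal (m ^ 2 - 2 * η * |m|) := by
        gcongr
        exact h.le_hausdorff_frontier
    _ = ∫⁻ x in frontier Ω, ENNReal.ofReal (m ^ 2 - 2 * η * |m|) ∂μH[1] := by
        rw [setLIntegral_const, mul_comm]
    _ ≤ _ := by
        refine setLIntegral_mono' isClosed_frontier.measurableSet fun x hx =>
          ENNReal.ofReal_le_ofReal ?_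
        have h3 := abs_le.1 (hval x hx)
        rw [← sq_abs m]
        rcases abs_cases m with ⟨h4, h5⟩ | ⟨h4, h5⟩ <;> rw [h4] <;>
          nlinarith [sq_nonneg (u x - m)]

lemma energy_le (h : IsArcBoundary Ω β L) (hconv : Convex ℝ Ω) (ho : IsOpen Ω)
    (hne : Ω.Nonempty) {u : E2 → ℝ} (hu : ContDiff ℝ (⊤ : ℕ∞) u)
    (hcu : HasCompactSupport u) {k : ℝ} (hk : 0 ≤ k) {F : ℝ → ℝ} (hF : Continuous F)
    (hF0 : ∀ t, 0 ≤ F t) (hFs : HasCompactSupport F) {c S : ℝ} (hc : 0 ≤ c) (hS : 0 ≤ S)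
    (hpt : ∀ x, ‖fderiv ℝ u x‖ ^ 2 + k * u x ^ 2 ≤
      F (infDist x Ω) + if infDist x Ω ≤ S then c else 0) :
    dirichletE Ω u + k * massE Ω u ≤
      (∫ t in Ioi 0, F t * (L + 2 * π * t)) + c * ((L + 2 * π * S) * S) := by
  have hL := h.pos
  have hπ := pi_pos
  set e : ℝ → ℝ := fun s => if s ≤ S then c else 0 with he
  have he0 : ∀ s, 0 ≤ e s := fun s => by simp only [he]; split_ifs <;> linarith
  have hem : Measurable e := Measurable.ite measurableSet_Iic measurable_const measurable_const
  have hFi : Integrable fun t => F t * (L + 2 * π * t) :=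
    Continuous.integrable_of_hasCompactSupport (by fun_prop) hFs.mul_right
  have hI0 : 0 ≤ ∫ t in Ioi 0, F t * (L + 2 * π * t) :=
    setIntegral_nonneg measurableSet_Ioi fun t ht => by
      have : (0 : ℝ) < t := ht
      exact mul_nonneg (hF0 t) (by positivity)
  have hsum : dirichletE Ω u + k * massE Ω u =
      ∫ x in extDom Ω, (‖fderiv ℝ u x‖ ^ 2 + k * u x ^ 2) := by
    rw [dirichletE, massE, ← integral_const_mul, ← integral_add
      (integrable_grad_sq hu hcu).integrableOn
      ((integrable_test_sq hu hcu).integrableOn.const_mul _)]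
  have hint : IntegrableOn (fun x => ‖fderiv ℝ u x‖ ^ 2 + k * u x ^ 2) (extDom Ω) :=
    (integrable_grad_sq hu hcu).integrableOn.add
      ((integrable_test_sq hu hcu).integrableOn.const_mul _)
  have hgm : Measurable fun t => ENNReal.ofReal (F t + e t) :=
    (hF.measurable.add hem).ennreal_ofReal
  have hcS : 0 ≤ c * ((L + 2 * π * S) * S) := by positivity
  rw [hsum, ← ENNReal.ofReal_le_ofReal_iff (add_nonneg hI0 hcS),
    ofReal_integral_eq_lintegral_ofReal hint (Eventually.of_forall fun _ => by positivity)]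
  calc ∫⁻ x in extDom Ω, ENNReal.ofReal (‖fderiv ℝ u x‖ ^ 2 + k * u x ^ 2)
      ≤ ∫⁻ x in extDom Ω, ENNReal.ofReal (F (infDist x Ω) + e (infDist x Ω)) :=
        lintegral_mono fun x => ENNReal.ofReal_le_ofReal (hpt x)
    _ ≤ ∫⁻ t in Ioi 0, ENNReal.ofReal (L + 2 * π * t) * ENNReal.ofReal (F t + e t) := by
        obtain ⟨o, hoΩ⟩ := hne
        exact h.lintegral_infDist_le hconv ho hoΩ hgm
    _ ≤ ∫⁻ t in Ioi 0, (ENNReal.ofReal (F t * (L + 2 * π * t)) +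
          (Ioc 0 S).indicator (fun _ => ENNReal.ofReal (c * (L + 2 * π * S))) t) := by
        refine setLIntegral_mono' measurableSet_Ioi fun t ht => ?_
        have ht0 : (0 : ℝ) < t := ht
        rw [ENNReal.ofReal_add (hF0 t) (he0 t), mul_add,
          ← ENNReal.ofReal_mul (by positivity), ← ENNReal.ofReal_mul (by positivity)]
        refine add_le_add (by rw [mul_comm]) ?_
        by_cases hts : t ≤ S
        · rw [indicator_of_mem (show t ∈ Ioc 0 S from ⟨ht0, hts⟩)]
          refine ENNReal.ofReal_le_ofReal ?_
          rw [show e t = c from if_pos hts, mul_comm c]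
          gcongr
        · simp [show e t = 0 from if_neg hts]
    _ = ENNReal.ofReal (∫ t in Ioi 0, F t * (L + 2 * π * t)) +
          ENNReal.ofReal (c * ((L + 2 * π * S) * S)) := by
        rw [lintegral_add_left (by fun_prop), lintegral_indicator measurableSet_Ioc,
          Measure.restrict_restrict measurableSet_Ioc,
          inter_eq_self_of_subset_left Ioc_subset_Ioi_self, setLIntegral_const, Real.volume_Ioc,
          ← ENNReal.ofReal_mul (by positivity),
          ← ofReal_integral_eq_lintegral_ofReal hFi.integrableOn
            ((ae_restrict_iff' measurableSet_Ioi).2 (Eventually.of_forall fun t ht => ?_))]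
        · congr 2
          ring
        · have : (0 : ℝ) < t := ht
          exact mul_nonneg (hF0 t) (by positivity)
    _ = _ := (ENNReal.ofReal_add hI0 hcS).symm

/-- Transplantation of a radial profile through the distance to `Ω`. -/
lemma exists_rayleigh_lt (h : IsArcBoundary Ω β L) (hconv : Convex ℝ Ω) (ho : IsOpen Ω)
    (hb : IsBounded Ω) (hne : Ω.Nonempty) {α : ℝ} (hα : α < 0) {k : ℝ} (hk : 0 ≤ k)
    {φ : ℝ → ℝ} (hφ : ContDiff ℝ 1 φ) (hc : HasCompactSupport φ)
    (hlt : ∫ t in Ioi 0, (deriv φ t ^ 2 + k * φ t ^ 2) * (L + 2 * π * t) < -α * L * φ 0 ^ 2) :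
    ∃ q ∈ rayleighSet α Ω, q < -k := by
  have hL := h.pos
  have hπ := pi_pos
  have hφc := hφ.continuous
  have hdc : Continuous (deriv φ) := hφ.continuous_deriv le_rfl
  obtain ⟨Λ₁, hΛ₁⟩ := hc.exists_bound_of_continuous hφc
  obtain ⟨Λ₂, hΛ₂⟩ := hc.deriv.exists_bound_of_continuous hdc
  obtain ⟨T₀, hT₀⟩ := hc.isCompact.isBounded.subset_closedBall 0
  set T := max T₀ 0 with hTdef
  have hT0 : 0 ≤ T := le_max_right _ _
  have hT : ∀ t, T < t → φ t = 0 := fun t ht => by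
    by_contra hne
    have h1 := hT₀ (subset_tsupport φ hne)
    rw [mem_closedBall, Real.dist_eq, sub_zero] at h1
    exact absurd (((le_abs_self t).trans h1).trans (le_max_left _ 0)) (not_le.2 ht)
  have hΛ₁0 : 0 ≤ Λ₁ := (norm_nonneg _).trans (hΛ₁ 0)
  have hΛ₂0 : 0 ≤ Λ₂ := (norm_nonneg _).trans (hΛ₂ 0)
  set I : ℝ := ∫ t in Ioi 0, (deriv φ t ^ 2 + k * φ t ^ 2) * (L + 2 * π * t) with hI
  set C₁ : ℝ := 2 * Λ₂ + 1 + k * (2 * Λ₁ + 1) with hC₁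
  have hC₁0 : 0 ≤ C₁ := by positivity
  set C : ℝ := C₁ * ((L + 2 * π * (T + 1)) * (T + 1)) with hC
  have hC0 : 0 ≤ C := by positivity
  obtain ⟨η, hη0, hη1, hηC⟩ : ∃ η : ℝ, 0 < η ∧ η ≤ 1 ∧
      I + η * C < -α * (L * (φ 0 ^ 2 - 2 * η * |φ 0|)) := by
    set E := C + 2 * (-α * L * |φ 0|) with hE
    have hE0 : 0 ≤ E := by
      have : 0 ≤ -α * L * |φ 0| := mul_nonneg (mul_nonneg (by linarith) hL.le) (abs_nonneg _)
      positivity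
    set g := -α * L * φ 0 ^ 2 - I with hg
    have hg0 : 0 < g := by linarith
    refine ⟨min 1 (g / (2 * (E + 1))), by positivity, min_le_left _ _, ?_⟩
    have h1 : min 1 (g / (2 * (E + 1))) * E < g := by
      calc min 1 (g / (2 * (E + 1))) * E ≤ g / (2 * (E + 1)) * E := by
            gcongr; exact min_le_right _ _
        _ < g := by
            rw [div_mul_eq_mul_div, div_lt_iff₀ (by positivity)]
            nlinarith
    rw [hE] at h1
    linarith
  obtain ⟨r, hr, hscale⟩ := exists_scale hφ hT hc hη0
  set e : ℝ → ℝ := fun s => if s ≤ T + 1 then η else 0 with he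
  have he0 : ∀ s, 0 ≤ e s := fun s => by simp only [he]; split_ifs <;> linarith
  have hem : Measurable e := Measurable.ite measurableSet_Iic measurable_const measurable_const
  have hvc : Continuous fun x => φ (infDist x Ω) := hφc.comp (continuous_infDist_pt _)
  obtain ⟨u, hu, hcu, hval, hgrad⟩ := exists_mollification hvc
    (hasCompactSupport_comp_infDist hb hne hT) hr
  have hdist : ∀ x, ∀ a ∈ ball x (2 * r), |infDist a Ω - infDist x Ω| < 2 * r := fun x a ha => by
    have := (lipschitz_infDist_pt Ω).dist_le_mul a x
    rw [NNReal.coe_one, one_mul, Real.dist_eq] at this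
    exact this.trans_lt ha
  have hu1 : ∀ x, |u x - φ (infDist x Ω)| ≤ e (infDist x Ω) := fun x =>
    hval x _ fun y hy => (hscale _ _ _ (infDist x Ω) rfl
      (hdist x y (ball_subset_ball (by linarith) hy)) (by simpa using hr)).1
  have hu2 : ∀ x, ‖fderiv ℝ u x‖ ≤ |deriv φ (infDist x Ω)| + e (infDist x Ω) := fun x => by
    refine hgrad x _ (add_nonneg (abs_nonneg _) (he0 _)) fun a ha b hb => ?_
    refine ((hscale _ _ _ _ rfl (hdist x a ha) (hdist x b hb)).2).trans ?_
    refine mul_le_mul_of_nonneg_left ?_ (add_nonneg (abs_nonneg _) (he0 _))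
    have := (lipschitz_infDist_pt Ω).dist_le_mul a b
    rwa [NNReal.coe_one, one_mul, Real.dist_eq, dist_eq_norm] at this
  set F : ℝ → ℝ := fun t => deriv φ t ^ 2 + k * φ t ^ 2 with hF
  have hFc : Continuous F := by fun_prop
  have hF0 : ∀ t, 0 ≤ F t := fun t => by positivity
  have hsq : ∀ {a b c Λ : ℝ}, 0 ≤ a → a ≤ b + c → 0 ≤ b → b ≤ Λ → 0 ≤ c → c ≤ 1 →
      a ^ 2 ≤ b ^ 2 + c * (2 * Λ + 1) := fun {a b c Λ} ha hab hb hbΛ hc0 hc1 => by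
    have h1 : a ^ 2 ≤ (b + c) ^ 2 := pow_le_pow_left₀ ha hab 2
    nlinarith [mul_nonneg hc0 (sub_nonneg.2 hbΛ), mul_nonneg hc0 (sub_nonneg.2 hc1)]
  have he1 : ∀ s, e s ≤ 1 := fun s => by simp only [he]; split_ifs <;> linarith
  have hpt : ∀ x, ‖fderiv ℝ u x‖ ^ 2 + k * u x ^ 2 ≤
      F (infDist x Ω) + C₁ * e (infDist x Ω) := fun x => by
    set s := infDist x Ω
    have h1 := hsq (norm_nonneg _) (hu2 x) (abs_nonneg _) (hΛ₂ s) (he0 s) (he1 s)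
    have h2 : |u x| ≤ |φ s| + e s := by
      have := abs_sub_abs_le_abs_sub (u x) (φ s)
      linarith [hu1 x]
    have h3 := hsq (abs_nonneg _) h2 (abs_nonneg _) (hΛ₁ s) (he0 s) (he1 s)
    rw [sq_abs] at h1
    rw [sq_abs, sq_abs] at h3
    have h4 := mul_le_mul_of_nonneg_left h3 hk
    simp only [hF, hC₁]
    linarith
  have hFs : HasCompactSupport F := by
    have h1 := hc.deriv.comp_left (g := fun x : ℝ => x ^ 2) (by simp)
    have h2 := hc.comp_left (g := fun x : ℝ => k * x ^ 2) (by simp)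
    exact h1.add h2
  have henergy : dirichletE Ω u + k * massE Ω u ≤ I + η * C := by
    have h1 := h.energy_le hconv ho hne hu hcu hk hFc hF0 hFs (c := C₁ * η) (S := T + 1)
      (by positivity) (by positivity) fun x => by
        refine (hpt x).trans_eq ?_
        simp only [he, mul_ite, mul_zero]
    refine h1.trans_eq ?_
    rw [hC]
    ring
  have hbd : L * (φ 0 ^ 2 - 2 * η * |φ 0|) ≤ boundaryE Ω u :=
    h.le_boundaryE hu hcu fun x hx => by
      have h1 := hu1 x
      rw [infDist_zero_of_mem_closure (frontier_subset_closure hx)] at h1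
      rwa [show e 0 = η from if_pos (by linarith)] at h1
  have hneg : dirichletE Ω u + α * boundaryE Ω u + k * massE Ω u < 0 := by
    have := mul_le_mul_of_nonneg_left hbd (show 0 ≤ -α by linarith)
    linarith
  have hnz : ∃ x ∈ extDom Ω, u x ≠ 0 := by
    by_contra! hz
    have hop : IsOpen (extDom Ω) := isClosed_closure.isOpen_compl
    have h1 : massE Ω u = 0 := setIntegral_eq_zero_of_forall_eq_zero fun x hx => by simp [hz x hx]
    have h2 : dirichletE Ω u = 0 := setIntegral_eq_zero_of_forall_eq_zero fun x hx => by
      have : u =ᶠ[nhds x] fun _ => 0 := by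
        filter_upwards [hop.mem_nhds hx] with y hy using hz y hy
      simp [this.fderiv_eq]
    obtain ⟨K, -, M, -, hle⟩ := h.boundaryE_le hconv ho hne
    have h3 := hle 1 one_pos u hu hcu
    rw [h1, h2] at h3
    have h4 : boundaryE Ω u = 0 := le_antisymm (by simpa using h3) (boundaryE_nonneg Ω u)
    rw [h1, h2, h4] at hneg
    simp at hneg
  refine ⟨_, ⟨u, hu, hcu, hnz, rfl⟩, ?_⟩
  rw [div_lt_iff₀ (massE_pos hu hcu hnz)]
  linarith

end IsArcBoundary

/-- The unit circle, parametrized by `[0, 1)`. -/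
def circ (s : ℝ) : E2 := !₂[cos (2 * π * s), sin (2 * π * s)]

/-- The velocity of `circ`. -/
def circ' (s : ℝ) : E2 := !₂[-(2 * π * sin (2 * π * s)), 2 * π * cos (2 * π * s)]

lemma hasDerivAt_circ (s : ℝ) : HasDerivAt circ (circ' s) s := by
  have h0 : HasDerivAt (fun s : ℝ => 2 * π * s) (2 * π) s := by
    simpa using (hasDerivAt_id s).const_mul (2 * π)
  refine hasDerivAt_of_coord fun i => ?_
  fin_cases i
  · simpa [circ, circ', mul_comm] using h0.cos
  · simpa [circ, circ', mul_comm] using h0.sin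

lemma norm_circ (s : ℝ) : ‖circ s‖ = 1 := by
  rw [← sq_eq_sq₀ (norm_nonneg _) zero_le_one, normSq_E2]
  simp [circ]

lemma norm_circ' (s : ℝ) : ‖circ' s‖ = 2 * π := by
  rw [← sq_eq_sq₀ (norm_nonneg _) (by positivity), normSq_E2]
  simp only [circ', Matrix.cons_val_zero, Matrix.cons_val_one]
  linear_combination (2 * π) ^ 2 * sin_sq_add_cos_sq (2 * π * s)

lemma circ_ne_zero (s : ℝ) : circ s ≠ 0 := fun h => by
  have := norm_circ s
  simp [h] at this

lemma injOn_circ : InjOn circ (Ico 0 1) := by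
  intro s hs t ht hst
  have h0 := congrArg (fun x : E2 => x 0) hst
  have h1 := congrArg (fun x : E2 => x 1) hst
  simp only [circ, Matrix.cons_val_zero, Matrix.cons_val_one] at h0 h1
  obtain ⟨k, hk⟩ := Real.Angle.angle_eq_iff_two_pi_dvd_sub.1 (Real.Angle.cos_sin_inj h0 h1)
  have hk' : s - t = k := by
    have : (2 * π) * (s - t) = (2 * π) * k := by rw [← hk]; ring
    exact mul_left_cancel₀ (by positivity) this
  have k1 : (k : ℝ) < 1 := by linarith [hs.2, ht.1]
  have k2 : (-1 : ℝ) < k := by linarith [hs.1, ht.2]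
  have k1' : k < 1 := by exact_mod_cast k1
  have k2' : -1 < k := by exact_mod_cast k2
  have : k = 0 := by omega
  rw [this] at hk'
  push_cast at hk'
  linarith

lemma exists_circ {x : E2} (hx : ‖x‖ = 1) : ∃ s ∈ Ico (0 : ℝ) 1, circ s = x := by
  set z : ℂ := ⟨x 0, x 1⟩ with hz
  have hn : ‖z‖ = 1 := by
    rw [← sq_eq_sq₀ (norm_nonneg _) zero_le_one, ← Complex.normSq_eq_norm_sq, Complex.normSq_apply]
    have := normSq_E2 x
    rw [hx] at this
    rw [this]; ring
  have hz0 : z ≠ 0 := fun h => by simp [h] at hn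
  have hcos := Complex.cos_arg hz0
  have hsin := Complex.sin_arg z
  rw [hn, div_one] at hcos hsin
  refine ⟨Int.fract (z.arg / (2 * π)), ⟨Int.fract_nonneg _, Int.fract_lt_one _⟩, ?_⟩
  have e : 2 * π * Int.fract (z.arg / (2 * π)) = z.arg - ⌊z.arg / (2 * π)⌋ * (2 * π) := by
    rw [Int.fract, mul_sub, mul_div_cancel₀ _ (by positivity)]; ring
  ext i
  fin_cases i
  · simp only [circ, e, Real.cos_sub_int_mul_two_pi]
    simpa using hcos
  · simp only [circ, e, Real.sin_sub_int_mul_two_pi]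
    simpa using hsin

lemma lipschitz_circle (c : E2) {R : ℝ} (hR : 0 < R) :
    LipschitzWith (2 * π * R).toNNReal fun s => c + R • circ s := by
  have hd : ∀ s, HasDerivAt (fun s => c + R • circ s) (R • circ' s) s := fun s =>
    ((hasDerivAt_circ s).const_smul R).const_add c
  refine lipschitzWith_of_nnnorm_deriv_le (fun s => (hd s).differentiableAt) fun s => ?_
  rw [(hd s).deriv, ← NNReal.coe_le_coe, coe_nnnorm, norm_smul, norm_circ',
    Real.norm_of_nonneg hR.le, Real.coe_toNNReal _ (by positivity)]
  linarith

lemma frontier_ball_subset (c : E2) {R : ℝ} (hR : 0 < R) :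
    frontier (ball c R) ⊆ (fun s => c + R • circ s) '' Ico 0 1 := by
  intro x hx
  rw [frontier_ball c hR.ne', mem_sphere_iff_norm] at hx
  obtain ⟨s, hs, he⟩ := exists_circ (x := R⁻¹ • (x - c)) (by
    rw [norm_smul, hx, norm_inv, Real.norm_of_nonneg hR.le, inv_mul_cancel₀ hR.ne'])
  refine ⟨s, hs, ?_⟩
  simp only [he]
  rw [smul_inv_smul₀ hR.ne', add_sub_cancel]

lemma mem_extDom_ball (c : E2) {R : ℝ} (hR : 0 < R) (s : ℝ) {t : ℝ} (ht : 0 < t) :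
    c + R • circ s + t • circ s ∈ extDom (ball c R) := by
  rw [extDom, closure_ball c hR.ne', mem_compl_iff, mem_closedBall, not_le, dist_eq_norm]
  have e : c + R • circ s + t • circ s - c = (R + t) • circ s := by rw [add_smul]; abel
  rw [e, norm_smul, norm_circ, mul_one, Real.norm_of_nonneg (by positivity)]
  linarith

/-- A test function on the exterior of a disk has a ray on which the one-dimensional quotient is
at most its Rayleigh quotient. -/
lemma exists_slice {u : E2 → ℝ} (hu : ContDiff ℝ (⊤ : ℕ∞) u) (hc : HasCompactSupport u) (c : E2)
    {R : ℝ} (hR : 0 < R) {α : ℝ} (hα : α < 0) {k : ℝ} (hk : 0 ≤ k)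
    (hlt : dirichletE (ball c R) u + α * boundaryE (ball c R) u + k * massE (ball c R) u < 0) :
    ∃ φ : ℝ → ℝ, ContDiff ℝ 1 φ ∧ HasCompactSupport φ ∧
      ∫ t in Ioi 0, (deriv φ t ^ 2 + k * φ t ^ 2) * (R + t) < -α * R * φ 0 ^ 2 := by
  have hπ := pi_pos
  set p : ℝ → E2 := fun s => c + R • circ s with hp
  have hφ : ∀ s, ContDiff ℝ 1 fun t : ℝ => u (p s + t • circ s) := fun s =>
    (contDiff_line hu _ _).of_le (by simp)
  have hφc : ∀ s, HasCompactSupport fun t : ℝ => u (p s + t • circ s) := fun s =>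
    hasCompactSupport_line hc _ (circ_ne_zero s)
  by_contra! hge
  set W : E2 → ℝ := fun x => ‖fderiv ℝ u x‖ ^ 2 + k * u x ^ 2 with hW
  have hWc : Continuous W := (continuous_grad_sq hu).add
    (continuous_const.mul (continuous_test_sq hu))
  have hcircc : Continuous circ := continuous_iff_continuousAt.2 fun s =>
    (hasDerivAt_circ s).continuousAt
  have hpc : Continuous p := by simp only [hp]; fun_prop
  have hpd : ∀ s, HasDerivAt p (R • circ' s) s := fun s =>
    ((hasDerivAt_circ s).const_smul R).const_add c
  have hrc : Continuous (ruled p circ) :=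
    (hpc.comp continuous_fst).add (continuous_snd.smul (hcircc.comp continuous_fst))
  have hmS : MeasurableSet (Ico (0 : ℝ) 1 ×ˢ Ioi (0 : ℝ)) :=
    measurableSet_Ico.prod measurableSet_Ioi
  have hslice : ∀ s, ENNReal.ofReal (-α * (2 * π * R) * u (p s) ^ 2) ≤
      ∫⁻ t in Ioi (0 : ℝ), ENNReal.ofReal (2 * π * (R + t)) *
        ENNReal.ofReal (W (ruled p circ (s, t))) := by
    intro s
    set φ : ℝ → ℝ := fun t => u (p s + t • circ s) with hφdef
    have h1 : -α * R * φ 0 ^ 2 ≤ ∫ t in Ioi 0, (deriv φ t ^ 2 + k * φ t ^ 2) * (R + t) :=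
      hge _ (hφ s) (hφc s)
    have h0 : φ 0 = u (p s) := by simp [hφdef]
    rw [h0] at h1
    have hφcont := (hφ s).continuous
    have hdcont := (hφ s).continuous_deriv le_rfl
    have hsupp : HasCompactSupport fun t => (deriv φ t ^ 2 + k * φ t ^ 2) * (R + t) := by
      have h1 := (hφc s).deriv.comp_left (g := fun x : ℝ => x ^ 2) (by simp)
      have h2 := (hφc s).comp_left (g := fun x : ℝ => k * x ^ 2) (by simp)
      exact (h1.add h2).mul_right
    have hcont : Continuous fun t => (deriv φ t ^ 2 + k * φ t ^ 2) * (R + t) := by fun_prop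
    have hi := hcont.integrable_of_hasCompactSupport (μ := volume) hsupp
    calc ENNReal.ofReal (-α * (2 * π * R) * u (p s) ^ 2)
        ≤ ENNReal.ofReal (2 * π * ∫ t in Ioi 0, (deriv φ t ^ 2 + k * φ t ^ 2) * (R + t)) := by
          refine ENNReal.ofReal_le_ofReal ?_
          have := mul_le_mul_of_nonneg_left h1 (show 0 ≤ 2 * π by positivity)
          linarith
      _ = ENNReal.ofReal (2 * π) *
            ∫⁻ t in Ioi 0, ENNReal.ofReal ((deriv φ t ^ 2 + k * φ t ^ 2) * (R + t)) := by
          rw [ENNReal.ofReal_mul (by positivity),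
            ofReal_integral_eq_lintegral_ofReal hi.integrableOn
              ((ae_restrict_iff' measurableSet_Ioi).2 (Eventually.of_forall fun t ht => ?_))]
          have : (0 : ℝ) < t := ht
          change (0 : ℝ) ≤ (deriv φ t ^ 2 + k * φ t ^ 2) * (R + t)
          positivity
      _ = ∫⁻ t in Ioi 0, ENNReal.ofReal (2 * π) *
            ENNReal.ofReal ((deriv φ t ^ 2 + k * φ t ^ 2) * (R + t)) :=
          (lintegral_const_mul _ hcont.measurable.ennreal_ofReal).symm
      _ ≤ _ := by
          refine setLIntegral_mono' measurableSet_Ioi fun t ht => ?_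
          have ht0 : (0 : ℝ) < t := ht
          rw [← ENNReal.ofReal_mul (by positivity), ← ENNReal.ofReal_mul (by positivity)]
          refine ENNReal.ofReal_le_ofReal ?_
          have h2 : deriv φ t ^ 2 ≤ ‖fderiv ℝ u (p s + t • circ s)‖ ^ 2 := by
            rw [(hasDerivAt_line hu (p s) (circ s) t).deriv, ← sq_abs]
            refine pow_le_pow_left₀ (abs_nonneg _) ?_ 2
            have := (fderiv ℝ u (p s + t • circ s)).le_opNorm (circ s)
            rwa [norm_circ, mul_one] at this
          change 2 * π * ((deriv φ t ^ 2 + k * φ t ^ 2) * (R + t)) ≤ 2 * π * (R + t) *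
            (‖fderiv ℝ u (p s + t • circ s)‖ ^ 2 + k * φ t ^ 2)
          calc _ = 2 * π * (R + t) * (deriv φ t ^ 2 + k * φ t ^ 2) := by ring
            _ ≤ _ := by gcongr
  have hinj : InjOn (ruled p circ) (Ico (0 : ℝ) 1 ×ˢ Ioi (0 : ℝ)) := by
    rintro ⟨s, a⟩ ⟨hs, ha⟩ ⟨t, b⟩ ⟨ht, hb⟩ heq
    have ha0 : (0 : ℝ) < a := ha
    have hb0 : (0 : ℝ) < b := hb
    have h1 : (R + a) • circ s = (R + b) • circ t := by
      have : c + R • circ s + a • circ s = c + R • circ t + b • circ t := heq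
      rw [add_assoc, add_assoc] at this
      rw [add_smul, add_smul]
      exact add_left_cancel this
    have h2 := congrArg norm h1
    rw [norm_smul, norm_smul, norm_circ, norm_circ, mul_one, mul_one,
      Real.norm_of_nonneg (by positivity), Real.norm_of_nonneg (by positivity)] at h2
    rw [← h2] at h1
    exact Prod.ext (injOn_circ hs ht (smul_right_injective E2 (by positivity) h1))
      (add_left_cancel h2)
  have harea : ∫⁻ z in Ico (0 : ℝ) 1 ×ˢ Ioi (0 : ℝ),
      ENNReal.ofReal (2 * π * (R + z.2)) * ENNReal.ofReal (W (ruled p circ z)) ≤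
      ∫⁻ x in extDom (ball c R), ENNReal.ofReal (W x) := by
    calc _ = ∫⁻ z in Ico (0 : ℝ) 1 ×ˢ Ioi (0 : ℝ),
          ENNReal.ofReal |crossE (R • circ' z.1 + z.2 • circ' z.1) (circ z.1)| *
            ENNReal.ofReal (W (ruled p circ z)) := by
          refine setLIntegral_congr_fun hmS fun z hz => ?_
          have hz2 : (0 : ℝ) < z.2 := hz.2
          have e : crossE (R • circ' z.1 + z.2 • circ' z.1) (circ z.1) =
              -(2 * π * (R + z.2)) := by
            simp only [crossE, circ, circ', PiLp.add_apply, PiLp.smul_apply, smul_eq_mul,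
              Matrix.cons_val_zero, Matrix.cons_val_one]
            linear_combination (-(2 * π * (R + z.2))) * sin_sq_add_cos_sq (2 * π * z.1)
          simp only [e, abs_neg]
          rw [abs_of_pos (by positivity)]
      _ = ∫⁻ x in ruled p circ '' (Ico (0 : ℝ) 1 ×ˢ Ioi (0 : ℝ)), ENNReal.ofReal (W x) :=
          (lintegral_image_ruled hpd hasDerivAt_circ hmS hinj fun x => ENNReal.ofReal (W x)).symm
      _ ≤ _ := by
          refine lintegral_mono_set ?_
          rintro _ ⟨z, hz, rfl⟩
          exact mem_extDom_ball c hR z.1 hz.2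
  have hWint : ∫⁻ x in extDom (ball c R), ENNReal.ofReal (W x) =
      ENNReal.ofReal (dirichletE (ball c R) u + k * massE (ball c R) u) := by
    rw [dirichletE, massE, ← integral_const_mul, ← integral_add
      (integrable_grad_sq hu hc).integrableOn
      ((integrable_test_sq hu hc).integrableOn.const_mul _)]
    refine (ofReal_integral_eq_lintegral_ofReal ?_ (Eventually.of_forall fun _ => by
      positivity)).symm
    exact (integrable_grad_sq hu hc).integrableOn.add
      ((integrable_test_sq hu hc).integrableOn.const_mul _)
  have hlip := lipschitz_circle c hR
  have hsub := frontier_ball_subset c hR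
  have hD0 := dirichletE_nonneg (ball c R) u
  have hM0 := massE_nonneg (ball c R) u
  have hα' : 0 ≤ -α := by linarith
  have hmain : ENNReal.ofReal (-α * boundaryE (ball c R) u) ≤
      ENNReal.ofReal (dirichletE (ball c R) u + k * massE (ball c R) u) := by
    have h1 := lintegral_hausdorff_le hlip hsub
      (g := fun x => ENNReal.ofReal (u x ^ 2)) (continuous_test_sq hu).measurable.ennreal_ofReal
    rw [← ofReal_boundaryE hu hc (hausdorff_lt_top hlip hsub)] at h1
    have hup : Continuous fun s => u (p s) ^ 2 := (continuous_test_sq hu).comp hpc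
    calc _ = ENNReal.ofReal (-α) * ENNReal.ofReal (boundaryE (ball c R) u) :=
          ENNReal.ofReal_mul hα'
      _ ≤ ENNReal.ofReal (-α) * (ENNReal.ofReal (2 * π * R) *
            ∫⁻ s in Ico (0 : ℝ) 1, ENNReal.ofReal (u (p s) ^ 2)) := by
          gcongr
          exact h1
      _ = ∫⁻ s in Ico (0 : ℝ) 1, ENNReal.ofReal (-α * (2 * π * R) * u (p s) ^ 2) := by
          rw [← mul_assoc, ← ENNReal.ofReal_mul hα',
            ← lintegral_const_mul _ hup.measurable.ennreal_ofReal]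
          refine lintegral_congr fun s => ?_
          rw [← ENNReal.ofReal_mul (mul_nonneg hα' (by positivity))]
      _ ≤ ∫⁻ s in Ico (0 : ℝ) 1, ∫⁻ t in Ioi (0 : ℝ),
            ENNReal.ofReal (2 * π * (R + t)) * ENNReal.ofReal (W (ruled p circ (s, t))) :=
          lintegral_mono hslice
      _ = ∫⁻ z in Ico (0 : ℝ) 1 ×ˢ Ioi (0 : ℝ),
            ENNReal.ofReal (2 * π * (R + z.2)) * ENNReal.ofReal (W (ruled p circ z)) := by
          have hWr : Measurable fun z => W (ruled p circ z) := (hWc.comp hrc).measurable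
          rw [Measure.volume_eq_prod, setLIntegral_prod (fun z : ℝ × ℝ =>
            ENNReal.ofReal (2 * π * (R + z.2)) * ENNReal.ofReal (W (ruled p circ z)))
            (Measurable.aemeasurable (by fun_prop))]
      _ ≤ _ := harea.trans_eq hWint
  rw [ENNReal.ofReal_le_ofReal_iff (by positivity)] at hmain
  linarith

/-- Transfer of the weighted one-dimensional quotient from a smaller to a larger radius, with room
to spare in the zeroth-order term. -/
lemma weighted_integral_le {φ : ℝ → ℝ} (hφ : ContDiff ℝ 1 φ) (hc : HasCompactSupport φ)
    {R₁ R₂ k δ : ℝ} (hR₂ : 0 < R₂) (hR : R₂ < R₁) (hδ : 0 ≤ δ)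
    (h1 : 2 * δ * R₁ * R₂ ≤ R₁ - R₂) (h2 : 2 * δ * (1 + R₁) * R₂ ≤ (R₁ - R₂) * k) :
    R₂ * ∫ t in Ioi 0, (deriv φ t ^ 2 + (k + 2 * δ) * φ t ^ 2) * (R₁ + t) ≤
      R₁ * ∫ t in Ioi 0, (deriv φ t ^ 2 + k * φ t ^ 2) * (R₂ + t) := by
  have hφcont := hφ.continuous
  have hdcont := hφ.continuous_deriv le_rfl
  have hint : ∀ a b : ℝ, Integrable fun t => (deriv φ t ^ 2 + a * φ t ^ 2) * (b + t) := by
    intro a b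
    refine Continuous.integrable_of_hasCompactSupport (by fun_prop) ?_
    have h1 := hc.deriv.comp_left (g := fun x : ℝ => x ^ 2) (by simp)
    have h2 := hc.comp_left (g := fun x : ℝ => a * x ^ 2) (by simp)
    exact (h1.add h2).mul_right
  set f : ℝ → ℝ := fun t => t * φ t ^ 2 with hf
  have hfd : ∀ t, deriv f t = φ t ^ 2 + 2 * t * φ t * deriv φ t := fun t => by
    have hd := (hφ.differentiable one_ne_zero t).hasDerivAt
    refine ((hasDerivAt_id' t).mul (hd.pow 2)).deriv.trans ?_
    simp only [Pi.pow_apply]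
    push_cast
    ring
  have hfc : ContDiff ℝ 1 f := contDiff_id.mul (hφ.pow 2)
  have hfs : HasCompactSupport f := (hc.comp_left (g := fun x : ℝ => x ^ 2) (by simp)).mul_left
  have hf0 : ∫ t in Ioi (0 : ℝ), deriv f t = 0 := by
    rw [hfs.integral_Ioi_deriv_eq hfc]; simp [hf]
  have hfi : Integrable (deriv f) :=
    (hfc.continuous_deriv le_rfl).integrable_of_hasCompactSupport hfs.deriv
  have key : ∫ t in Ioi (0 : ℝ), R₂ * ((deriv φ t ^ 2 + (k + 2 * δ) * φ t ^ 2) * (R₁ + t)) ≤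
      ∫ t in Ioi (0 : ℝ), (R₁ * ((deriv φ t ^ 2 + k * φ t ^ 2) * (R₂ + t)) +
        2 * δ * R₁ * R₂ * deriv f t) := by
    refine setIntegral_mono_on ((hint _ _).const_mul _).integrableOn
      (((hint _ _).const_mul _).add (hfi.const_mul _)).integrableOn measurableSet_Ioi ?_
    intro t ht
    have ht0 : (0 : ℝ) < t := ht
    rw [hfd]
    have e1 := mul_nonneg (sub_nonneg.2 h1) (mul_nonneg ht0.le (sq_nonneg (deriv φ t)))
    have e2 := mul_nonneg (sub_nonneg.2 h2) (mul_nonneg ht0.le (sq_nonneg (φ t)))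
    have e3 : 0 ≤ 2 * δ * R₁ * R₂ * t * (φ t + deriv φ t) ^ 2 := by
      have : 0 < R₁ := hR₂.trans hR
      positivity
    linarith
  rw [integral_add ((hint _ _).const_mul _).integrableOn (hfi.const_mul _).integrableOn,
    integral_const_mul, integral_const_mul, integral_const_mul, hf0, mul_zero, add_zero] at key
  exact key

/-- In two dimensions a point has zero capacity at infinity: logarithmic cutoffs have arbitrarily
small energy. -/
lemma exists_log_cutoff {L ε : ℝ} (hL : 0 < L) (hε : 0 < ε) :
    ∃ φ : ℝ → ℝ, ContDiff ℝ 1 φ ∧ HasCompactSupport φ ∧ φ 0 = 1 ∧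
      ∫ t in Ioi 0, deriv φ t ^ 2 * (L + 2 * π * t) < ε := by
  have hπ := pi_pos
  let χ : ContDiffBump (0 : ℝ) := ⟨1, 2, one_pos, one_lt_two⟩
  have hχ : ContDiff ℝ 1 (χ : ℝ → ℝ) := χ.contDiff
  have hχ0 : χ 0 = 1 := χ.one_of_mem_closedBall (by simp [χ])
  have hχ2 : ∀ y, 2 ≤ y → χ y = 0 := fun y hy => χ.zero_of_le_dist (by
    rw [Real.dist_eq, sub_zero]; exact hy.trans (le_abs_self y))
  obtain ⟨M, hM⟩ := χ.hasCompactSupport.deriv.exists_bound_of_continuous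
    (hχ.continuous_deriv le_rfl)
  set a : ℝ := (L + 4 * π) * M ^ 2 / ε + 1 with ha
  have ha0 : 0 < a := by positivity
  set g : ℝ → ℝ := fun t => log (1 + t ^ 2) / 2 with hg
  have hpos : ∀ t : ℝ, 0 < 1 + t ^ 2 := fun t => by positivity
  have hgd : ∀ t, HasDerivAt g (t / (1 + t ^ 2)) t := fun t => by
    have := ((((hasDerivAt_id' t).pow 2).const_add 1).log (hpos t).ne').div_const 2
    refine this.congr_deriv ?_
    have := (hpos t).ne'
    simp only [Pi.pow_apply] at *
    field_simp
    push_cast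
    ring_nf
  have hgc : ContDiff ℝ 1 g :=
    ((contDiff_const.add (contDiff_id.pow 2)).log fun t => (hpos t).ne').div_const 2
  set φ : ℝ → ℝ := fun t => χ (g t / a) with hφ
  have hφc : ContDiff ℝ 1 φ := hχ.comp (hgc.div_const a)
  set T : ℝ := √(exp (4 * a) - 1) with hT
  have he1 : 1 ≤ exp (4 * a) := one_le_exp (by positivity)
  have hT0 : 0 ≤ T := sqrt_nonneg _
  have hT2 : 1 + T ^ 2 = exp (4 * a) := by rw [hT, sq_sqrt (by linarith)]; ring
  have hgT : g T = 2 * a := by simp only [hg]; rw [hT2, log_exp]; ring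
  have hφT : ∀ t, T ≤ |t| → φ t = 0 := fun t ht => by
    refine hχ2 _ ?_
    rw [le_div_iff₀ ha0, ← hgT]
    simp only [hg]
    have : T ^ 2 ≤ t ^ 2 := by rw [← sq_abs t]; gcongr
    have := log_le_log (hpos T) (add_le_add_right this 1)
    linarith
  have hsupp : HasCompactSupport φ := HasCompactSupport.intro (isCompact_closedBall (0 : ℝ) T)
    fun t ht => hφT t (by
      rw [mem_closedBall, not_le, Real.dist_eq, sub_zero] at ht; exact ht.le)
  refine ⟨φ, hφc, hsupp, by simp [hφ, hg, hχ0], ?_⟩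
  have hdφ : ∀ t, deriv φ t = deriv χ (g t / a) * (t / (1 + t ^ 2) / a) := fun t =>
    ((hχ.differentiable one_ne_zero _).hasDerivAt.comp t ((hgd t).div_const a)).deriv
  have hdT : ∀ t, T < t → deriv φ t = 0 := fun t ht => by
    have : φ =ᶠ[nhds t] fun _ => 0 := by
      filter_upwards [lt_mem_nhds ht] with s hs using hφT s (hs.le.trans (le_abs_self s))
    simp [this.deriv_eq]
  have hcut : ∫ t in Ioi 0, deriv φ t ^ 2 * (L + 2 * π * t) =
      ∫ t in Ioc 0 T, deriv φ t ^ 2 * (L + 2 * π * t) :=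
    setIntegral_eq_of_subset_of_forall_sdiff_eq_zero measurableSet_Ioi Ioc_subset_Ioi_self
      fun t ht => by
        have : T < t := by
          by_contra! h
          exact ht.2 ⟨ht.1, h⟩
        simp [hdT t this]
  have hdcont := hφc.continuous_deriv le_rfl
  have hgcont : Continuous fun t : ℝ => t / (1 + t ^ 2) :=
    continuous_id.div (by fun_prop) fun t => (hpos t).ne'
  have hbound : ∀ t, 0 < t → deriv φ t ^ 2 * (L + 2 * π * t) ≤
      (L / 2 + 2 * π) * M ^ 2 / a ^ 2 * (t / (1 + t ^ 2)) := fun t ht => by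
    have h1 : deriv χ (g t / a) ^ 2 ≤ M ^ 2 := by
      rw [← sq_abs]
      exact pow_le_pow_left₀ (abs_nonneg _) (hM _) 2
    have h2 : (t / (1 + t ^ 2)) ^ 2 * (L + 2 * π * t) ≤ (L / 2 + 2 * π) * (t / (1 + t ^ 2)) := by
      have e1 : t / (1 + t ^ 2) ≤ 1 / 2 := by
        rw [div_le_div_iff₀ (hpos t) two_pos]; nlinarith [sq_nonneg (t - 1)]
      have e2 : t / (1 + t ^ 2) * t ≤ 1 := by
        rw [div_mul_eq_mul_div, div_le_one (hpos t)]; nlinarith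
      have e0 : 0 ≤ t / (1 + t ^ 2) := by positivity
      have e3 : t / (1 + t ^ 2) * (L + 2 * π * t) ≤ L / 2 + 2 * π := by nlinarith
      nlinarith
    rw [hdφ]
    calc _ = deriv χ (g t / a) ^ 2 / a ^ 2 * ((t / (1 + t ^ 2)) ^ 2 * (L + 2 * π * t)) := by ring_nf
      _ ≤ M ^ 2 / a ^ 2 * ((L / 2 + 2 * π) * (t / (1 + t ^ 2))) := by gcongr
      _ = _ := by ring
  have hle : ∫ t in Ioc 0 T, deriv φ t ^ 2 * (L + 2 * π * t) ≤
      ∫ t in Ioc 0 T, (L / 2 + 2 * π) * M ^ 2 / a ^ 2 * (t / (1 + t ^ 2)) := by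
    refine setIntegral_mono_on ?_ ?_ measurableSet_Ioc fun t ht => hbound t ht.1
    · exact (Continuous.integrableOn_Icc (by fun_prop)).mono_set Ioc_subset_Icc_self
    · exact (continuous_const.mul hgcont).integrableOn_Icc.mono_set Ioc_subset_Icc_self
  have hFTC : ∫ t in Ioc 0 T, t / (1 + t ^ 2) = 2 * a := by
    rw [← intervalIntegral.integral_of_le hT0,
      intervalIntegral.integral_eq_sub_of_hasDerivAt (fun t _ => hgd t)
        (hgcont.intervalIntegrable _ _), hgT]
    simp [hg]
  rw [integral_const_mul, hFTC] at hle
  rw [hcut]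
  refine hle.trans_lt ?_
  have : (L / 2 + 2 * π) * M ^ 2 / a ^ 2 * (2 * a) = (L + 4 * π) * M ^ 2 / a := by
    field_simp; ring_nf
  rw [this, div_lt_iff₀ ha0, ha, mul_add, mul_one, mul_div_cancel₀ _ hε.ne']
  linarith

/-- For `α < 0` the Robin eigenvalue of the exterior of a smooth convex planar set is negative. -/
lemma IsArcBoundary.robinEig_neg {β : ℝ → E2} {L : ℝ} {Ω : Set E2} (h : IsArcBoundary Ω β L)
    (hconv : Convex ℝ Ω) (ho : IsOpen Ω) (hb : IsBounded Ω) (hne : Ω.Nonempty)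
    {α : ℝ} (hα : α < 0) : robinEig α Ω < 0 := by
  obtain ⟨φ, hφ, hc, h0, hlt⟩ := exists_log_cutoff h.pos
    (mul_pos (neg_pos.2 hα) h.pos)
  obtain ⟨q, hq, hq0⟩ := h.exists_rayleigh_lt hconv ho hb hne hα le_rfl hφ hc
    (by simpa [h0] using hlt)
  exact (csInf_le (h.bddBelow_rayleighSet hconv ho hne hα) hq).trans_lt (by simpa using hq0)

/-- The exterior eigenvalue of a smooth convex set of perimeter more than `2 * π * R` lies strictly
below that of a disk of radius `R`. -/
theorem IsArcBoundary.robinEig_lt_ball {β : ℝ → E2} {L : ℝ} {Ω : Set E2} (h : IsArcBoundary Ω β L)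
    (hconv : Convex ℝ Ω) (ho : IsOpen Ω) (hb : IsBounded Ω) (hne : Ω.Nonempty)
    {α : ℝ} (hα : α < 0) (c : E2) {R : ℝ} (hR : 0 < R) (hRL : 2 * π * R < L) :
    robinEig α Ω < robinEig α (ball c R) := by
  have hπ := pi_pos
  rcases le_or_gt 0 (robinEig α (ball c R)) with hμ | hμ
  · exact (h.robinEig_neg hconv ho hb hne hα).trans_le hμ
  obtain ⟨K, hK⟩ : ∃ K, K = -robinEig α (ball c R) := ⟨_, rfl⟩
  have hK0 : 0 < K := by linarith
  set R₁ := L / (2 * π) with hR₁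
  have hL : L = 2 * π * R₁ := by rw [hR₁]; field_simp
  have hRR : R < R₁ := by rw [hR₁, lt_div_iff₀ (by positivity)]; linarith
  have hR₁0 : 0 < R₁ := hR.trans hRR
  obtain ⟨δ, hδ0, hδK, hδ1, hδ2⟩ : ∃ δ : ℝ, 0 < δ ∧ δ ≤ K / 2 ∧ 2 * δ * R₁ * R ≤ R₁ - R ∧
      2 * δ * (1 + R₁) * R ≤ (R₁ - R) * (K / 2) := by
    have hd : 0 < R₁ - R := sub_pos.2 hRR
    refine ⟨min (K / 2) (min ((R₁ - R) / (2 * R₁ * R)) ((R₁ - R) * (K / 2) / (2 * (1 + R₁) * R))),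
      by positivity, min_le_left _ _, ?_, ?_⟩
    · have := (min_le_right (K / 2) _).trans (min_le_left ((R₁ - R) / (2 * R₁ * R))
        ((R₁ - R) * (K / 2) / (2 * (1 + R₁) * R)))
      rw [le_div_iff₀ (by positivity)] at this
      linarith
    · have := (min_le_right (K / 2) _).trans (min_le_right ((R₁ - R) / (2 * R₁ * R))
        ((R₁ - R) * (K / 2) / (2 * (1 + R₁) * R)))
      rw [le_div_iff₀ (by positivity)] at this
      linarith
  set k := K - δ with hk
  have hk2 : K / 2 ≤ k := by linarith
  have hne' : (rayleighSet α (ball c R)).Nonempty := by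
    by_contra! hempty
    rw [robinEig_eq, hempty, Real.sInf_empty] at hμ
    exact lt_irrefl _ hμ
  obtain ⟨q, ⟨u, hu, hcu, hnz, rfl⟩, hq⟩ :=
    exists_lt_of_csInf_lt hne' (show sInf (rayleighSet α (ball c R)) < -k by
      rw [← robinEig_eq]; linarith)
  rw [div_lt_iff₀ (massE_pos hu hcu hnz)] at hq
  obtain ⟨φ, hφ, hc, hlt⟩ := exists_slice hu hcu c hR hα (k := k) (by linarith) (by linarith)
  have hw := weighted_integral_le hφ hc (k := k) hR hRR hδ0.le hδ1
    (hδ2.trans (mul_le_mul_of_nonneg_left hk2 (sub_pos.2 hRR).le))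
  have hlt' : ∫ t in Ioi 0, (deriv φ t ^ 2 + (k + 2 * δ) * φ t ^ 2) * (L + 2 * π * t) <
      -α * L * φ 0 ^ 2 := by
    have e : ∀ t, (deriv φ t ^ 2 + (k + 2 * δ) * φ t ^ 2) * (L + 2 * π * t) =
        2 * π * ((deriv φ t ^ 2 + (k + 2 * δ) * φ t ^ 2) * (R₁ + t)) := fun t => by rw [hL]; ring
    simp only [e]
    rw [integral_const_mul, hL]
    have h1 := hw.trans_lt (mul_lt_mul_of_pos_left hlt hR₁0)
    have h2 : R * (∫ t in Ioi 0, (deriv φ t ^ 2 + (k + 2 * δ) * φ t ^ 2) * (R₁ + t)) <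
        R * (-α * R₁ * φ 0 ^ 2) := by linarith
    have h3 := mul_lt_mul_of_pos_left (lt_of_mul_lt_mul_left h2 hR.le)
      (show 0 < 2 * π by positivity)
    linarith
  obtain ⟨q', hq', hlt''⟩ := h.exists_rayleigh_lt hconv ho hb hne hα (k := k + 2 * δ)
    (by linarith) hφ hc hlt'
  have := csInf_le (h.bddBelow_rayleighSet hconv ho hne hα) hq'
  rw [robinEig_eq α Ω]
  linarith

/-- Uniqueness of the optimiser, isochoric case: a non-disk convex set gives a
strictly smaller exterior eigenvalue than the disk of the same area. -/
theorem reverse_spectral_isochoric_exterior_strict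
    (α : ℝ) (hα : α < 0) (Ω : Set E2) (hne : Ω.Nonempty) (ho : IsOpen Ω)
    (hb : IsBounded Ω) (hconv : Convex ℝ Ω) (hsm : HasSmoothBoundary Ω)
    (hnd : ¬ ∃ (x : E2) (r : ℝ), Ω = ball x r)
    (c : E2) (R₂ : ℝ) (hR₂ : 0 < R₂)
    (harea : volume (ball c R₂) = volume Ω) :
    robinEig α Ω < robinEig α (ball c R₂) := by
  obtain ⟨β, L, h⟩ := hsm.exists_isArcBoundary
  refine h.robinEig_lt_ball hconv ho hb hne hα c hR₂
    (h.two_pi_mul_lt hconv ho hb hne hnd hR₂ ?_)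
  rw [← harea, EuclideanSpace.volume_ball_fin_two, mul_comm π,
    ENNReal.ofReal_mul (by positivity), ENNReal.ofReal_pow hR₂.le]

end
end

section
/- Nonexistence of negative-energy radial weak eigenfunctions on the half-line with weight t (key lemma in the uniqueness proof of Section 5.2): Let λ < 0 and let ψ : (0,∞) → ℝ be a continuously differentiable function with ∫₀^∞ ψ(t)²·t dt < ∞ and ∫₀^∞ ψ′(t)²·t dt < ∞, satisfying the weak eigenvalue equation ∫₀^∞ φ′(t)·ψ′(t)·t dt = λ·∫₀^∞ φ(t)·ψ(t)·t dt for every φ ∈ C_c^∞((0,∞)). Then ∫₀^∞ ψ′(t)²·t dt = λ·∫₀^∞ ψ(t)²·t dt, and consequently ψ is identically zero. -/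
open MeasureTheory Metric Set Bornology Real Filter

noncomputable section

/-- The product of a continuous function compactly supported in an open set with a function
continuous on that set is integrable. -/
theorem integrable_mul_of_tsupport_subset {U : Set ℝ} (hU : IsOpen U) {g G : ℝ → ℝ}
    (hg : Continuous g) (hgc : HasCompactSupport g) (hgU : tsupport g ⊆ U)
    (hG : ContinuousOn G U) : Integrable (fun t => g t * G t) :=
  (ContinuousOn.continuous_of_tsupport_subset (hg.continuousOn.mul hG) hU
    (tsupport_mul_subset_left.trans hgU)).integrable_of_hasCompactSupport hgc.mul_right

/-- A test function on `(0, ∞)` with zero mean is the derivative of a test function. -/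
theorem exists_testFunction_deriv_eq {h : ℝ → ℝ} (hh : ContDiff ℝ (⊤ : ℕ∞) h)
    (hc : HasCompactSupport h) (hs : tsupport h ⊆ Ioi 0) (h0 : ∫ t, h t = 0) :
    ∃ φ : ℝ → ℝ, ContDiff ℝ (⊤ : ℕ∞) φ ∧ HasCompactSupport φ ∧ tsupport φ ⊆ Ioi 0 ∧
      deriv φ = h := by
  obtain ⟨a, ha, hleast⟩ := (hc.isCompact.insert 1).exists_isLeast (insert_nonempty _ _)
  obtain ⟨b, -, hgreatest⟩ := (hc.isCompact.insert 1).exists_isGreatest (insert_nonempty _ _)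
  have ha0 : 0 < a := by
    rcases ha with rfl | ha
    · exact one_pos
    · exact hs ha
  have hsub : ∀ t, h t ≠ 0 → a ≤ t ∧ t ≤ b := fun t ht =>
    have hmem := mem_insert_of_mem 1 (subset_tsupport h ht)
    ⟨hleast hmem, hgreatest hmem⟩
  have hd : ∀ x, HasDerivAt (fun x => ∫ t in (a / 2)..x, h t) (h x) x := fun x =>
    hh.continuous.integral_hasStrictDerivAt (a / 2) x |>.hasDerivAt
  have hderiv : deriv (fun x => ∫ t in (a / 2)..x, h t) = h := funext fun x => (hd x).deriv
  have hsupp : Function.support (fun x => ∫ t in (a / 2)..x, h t) ⊆ Icc (a / 2) b := by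
    intro x hx
    by_contra hx'
    refine hx ?_
    rcases lt_or_ge x (a / 2) with hlt | hge
    · refine intervalIntegral.integral_zero_ae (.of_forall fun t ht => ?_)
      by_contra hne
      rw [uIoc_of_ge hlt.le] at ht
      linarith [(hsub t hne).1, ht.2]
    · have hbx : b < x := not_le.1 fun hle => hx' ⟨hge, hle⟩
      refine (intervalIntegral.integral_eq_integral_of_support_subset fun t ht => ?_).trans h0
      have := hsub t ht
      constructor <;> linarith
  have htsupp := closure_minimal hsupp isClosed_Icc
  refine ⟨fun x => ∫ t in (a / 2)..x, h t, ?_, ?_, ?_, hderiv⟩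
  · exact contDiff_infty_iff_deriv.2 ⟨fun x => (hd x).differentiableAt, hderiv.symm ▸ hh⟩
  · exact isCompact_Icc.of_isClosed_subset (isClosed_tsupport _) htsupp
  · exact fun x hx => (half_pos ha0).trans_le (htsupp hx).1

/-- The du Bois-Reymond lemma on the half-line. -/
theorem exists_eq_const_of_integral_deriv_mul_eq_zero {G : ℝ → ℝ}
    (hG : ContinuousOn G (Ioi 0))
    (h : ∀ φ : ℝ → ℝ, ContDiff ℝ (⊤ : ℕ∞) φ → HasCompactSupport φ → tsupport φ ⊆ Ioi 0 →
      ∫ t, deriv φ t * G t = 0) :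
    ∃ c, ∀ t ∈ Ioi (0 : ℝ), G t = c := by
  let β : ContDiffBump (1 : ℝ) := ⟨1 / 4, 1 / 2, by norm_num, by norm_num⟩
  set χ : ℝ → ℝ := β.normed volume with hχ
  have hχd : ContDiff ℝ (⊤ : ℕ∞) χ := β.contDiff_normed
  have hχc : HasCompactSupport χ := β.hasCompactSupport_normed
  have hχs : tsupport χ ⊆ Ioi 0 := by
    rw [hχ, β.tsupport_normed_eq, Real.closedBall_eq_Icc]
    intro x hx
    have : (1 : ℝ) - 1 / 2 ≤ x := hx.1
    exact (by norm_num : (0 : ℝ) < 1 - 1 / 2).trans_le this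
  have hχ1 : ∫ t, χ t = 1 := β.integral_normed
  set c := ∫ t, χ t * G t with hcdef
  refine ⟨c, ?_⟩
  have hint : ∀ g : ℝ → ℝ, ContDiff ℝ (⊤ : ℕ∞) g → HasCompactSupport g → tsupport g ⊆ Ioi 0 →
      ∫ t, g t • (G t - c) = 0 := by
    intro g hg hgc hgs
    have hgi := hg.continuous.integrable_of_hasCompactSupport (μ := volume) hgc
    have hχi := hχd.continuous.integrable_of_hasCompactSupport (μ := volume) hχc
    have hgG := integrable_mul_of_tsupport_subset isOpen_Ioi hg.continuous hgc hgs hG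
    have hχG := integrable_mul_of_tsupport_subset isOpen_Ioi hχd.continuous hχc hχs hG
    set m := ∫ t, g t with hm
    have hmχ : ContDiff ℝ (⊤ : ℕ∞) fun t => m * χ t := contDiff_const.mul hχd
    have hmχs : tsupport (fun t => m * χ t) ⊆ tsupport χ := tsupport_mul_subset_right
    obtain ⟨φ, hφ, hφc, hφs, hφd⟩ := exists_testFunction_deriv_eq (h := fun t => g t - m * χ t)
      (hg.sub hmχ) (hgc.sub hχc.mul_left)
      ((tsupport_sub g fun t => m * χ t).trans (union_subset hgs (hmχs.trans hχs)))
      (by rw [integral_sub hgi (hχi.const_mul m), integral_const_mul, hχ1, ← hm]; ring)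
    have key := h φ hφ hφc hφs
    rw [hφd] at key
    calc ∫ t, g t • (G t - c) = (∫ t, g t * G t) - m * c := by
          simp_rw [smul_eq_mul, mul_sub]
          rw [integral_sub hgG (hgi.mul_const c), integral_mul_const]
      _ = ∫ t, (g t - m * χ t) * G t := by
          simp_rw [sub_mul, mul_assoc]
          rw [integral_sub hgG (hχG.const_mul m), integral_const_mul]
      _ = 0 := key
  have hcont : ContinuousOn (fun t => G t - c) (Ioi 0) := hG.sub continuousOn_const
  have hae := isOpen_Ioi.ae_eq_zero_of_integral_contDiff_smul_eq_zero
    (hcont.locallyIntegrableOn measurableSet_Ioi) hint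
  have heq : EqOn (fun t => G t - c) 0 (Ioi 0) :=
    Measure.eqOn_open_of_ae_eq ((ae_restrict_iff' measurableSet_Ioi).2 hae) isOpen_Ioi hcont
      continuousOn_const
  exact fun t ht => sub_eq_zero.1 (heq ht)

/-- A continuous function on the half-line whose weak derivative is a continuous function `f` is
differentiable with derivative `f`. -/
theorem hasDerivAt_of_weak_deriv {v f : ℝ → ℝ} (hv : ContinuousOn v (Ioi 0))
    (hf : ContinuousOn f (Ioi 0))
    (h : ∀ φ : ℝ → ℝ, ContDiff ℝ (⊤ : ℕ∞) φ → HasCompactSupport φ → tsupport φ ⊆ Ioi 0 →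
      ∫ t, deriv φ t * v t = -∫ t, φ t * f t) :
    ∀ t ∈ Ioi (0 : ℝ), HasDerivAt v (f t) t := by
  have hF : ∀ t ∈ Ioi (0 : ℝ), HasDerivAt (fun x => ∫ s in (1 : ℝ)..x, f s) (f t) t := by
    intro t ht
    refine intervalIntegral.integral_hasDerivAt_right
      ((hf.mono fun s hs => ?_).intervalIntegrable)
      (hf.stronglyMeasurableAtFilter isOpen_Ioi t ht) (hf.continuousAt (Ioi_mem_nhds ht))
    exact (lt_min one_pos ht).trans_le hs.1
  have hFc : ContinuousOn (fun x => ∫ s in (1 : ℝ)..x, f s) (Ioi 0) := fun t ht =>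
    (hF t ht).continuousAt.continuousWithinAt
  obtain ⟨c, hc⟩ := exists_eq_const_of_integral_deriv_mul_eq_zero (hv.sub hFc) (by
    intro φ hφ hφc hφs
    have hφ' : Continuous (deriv φ) := hφ.continuous_deriv (by simp)
    have hφ's : tsupport (deriv φ) ⊆ Ioi 0 := tsupport_deriv_subset.trans hφs
    have hi : ∀ {G : ℝ → ℝ}, ContinuousOn G (Ioi 0) → Integrable fun t => deriv φ t * G t :=
      integrable_mul_of_tsupport_subset isOpen_Ioi hφ' hφc.deriv hφ's
    have hj : ∀ {G : ℝ → ℝ}, ContinuousOn G (Ioi 0) → Integrable fun t => φ t * G t :=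
      integrable_mul_of_tsupport_subset isOpen_Ioi hφ.continuous hφc hφs
    have hparts := integral_mul_deriv_eq_deriv_mul_of_integrable (u := φ) (u' := deriv φ)
      (v := fun x => ∫ s in (1 : ℝ)..x, f s) (v' := f)
      (fun x _ => (hφ.differentiable (by simp) x).hasDerivAt) (fun x hx => hF x (hφs hx))
      (hj hf) (hi hFc) (hj hFc)
    simp_rw [Pi.sub_apply, mul_sub]
    rw [integral_sub (hi hv) (hi hFc), h φ hφ hφc hφs, hparts]
    ring)
  intro t ht
  refine ((hF t ht).add_const c).congr_of_eventuallyEq ?_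
  filter_upwards [Ioi_mem_nhds ht] with x hx
  have : v x - (∫ s in (1 : ℝ)..x, f s) = c := hc x hx
  linarith

/-- Nonexistence of negative-energy radial weak eigenfunctions on the half-line with
weight `t`. -/
theorem no_negative_weak_eigenfunction_halfline
    (lam : ℝ) (hlam : lam < 0) (ψ ψ' : ℝ → ℝ)
    (hderiv : ∀ t ∈ Ioi (0:ℝ), HasDerivAt ψ (ψ' t) t)
    (hcont : ContinuousOn ψ' (Ioi 0))
    (hint1 : IntegrableOn (fun t => ψ t ^ 2 * t) (Ioi 0))
    (hint2 : IntegrableOn (fun t => ψ' t ^ 2 * t) (Ioi 0))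
    (hweak : ∀ φ : ℝ → ℝ, ContDiff ℝ (⊤ : ℕ∞) φ → HasCompactSupport φ →
      tsupport φ ⊆ Ioi 0 →
      (∫ t in Ioi (0:ℝ), deriv φ t * ψ' t * t) =
        lam * ∫ t in Ioi (0:ℝ), φ t * ψ t * t) :
    (∫ t in Ioi (0:ℝ), ψ' t ^ 2 * t) = lam * (∫ t in Ioi (0:ℝ), ψ t ^ 2 * t) ∧
    ∀ t ∈ Ioi (0:ℝ), ψ t = 0 := by
  have hψc : ContinuousOn ψ (Ioi 0) := fun t ht =>
    (hderiv t ht).continuousAt.continuousWithinAt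
  set v : ℝ → ℝ := fun t => ψ' t * t with hvdef
  have hv : ∀ t ∈ Ioi (0 : ℝ), HasDerivAt v (-lam * (ψ t * t)) t := by
    refine hasDerivAt_of_weak_deriv (hcont.mul continuousOn_id)
      (continuousOn_const.mul (hψc.mul continuousOn_id)) fun φ hφ hφc hφs => ?_
    have h0 : ∀ t, t ∉ Ioi (0 : ℝ) → φ t = 0 ∧ deriv φ t = 0 := fun t ht =>
      ⟨image_eq_zero_of_notMem_tsupport fun h => ht (hφs h),
        image_eq_zero_of_notMem_tsupport fun h => ht (hφs (tsupport_deriv_subset h))⟩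
    have key := hweak φ hφ hφc hφs
    rw [setIntegral_eq_integral_of_forall_compl_eq_zero fun t ht => by simp [(h0 t ht).2],
      setIntegral_eq_integral_of_forall_compl_eq_zero fun t ht => by simp [(h0 t ht).1]] at key
    calc ∫ t, deriv φ t * v t = ∫ t, deriv φ t * ψ' t * t := by simp_rw [hvdef, mul_assoc]
      _ = -∫ t, φ t * (-lam * (ψ t * t)) := by
        rw [key, ← integral_const_mul, ← integral_neg]
        congr 1 with t
        ring
  have hu : ∀ t ∈ Ioi (0 : ℝ),
      HasDerivAt (fun t => ψ t * v t) (ψ' t ^ 2 * t - lam * (ψ t ^ 2 * t)) t := by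
    intro t ht
    refine ((hderiv t ht).mul (hv t ht)).congr_deriv ?_
    simp only [hvdef]
    ring
  have hu_mono : MonotoneOn (fun t => ψ t * v t) (Ioi 0) := by
    refine monotoneOn_of_hasDerivWithinAt_nonneg (convex_Ioi 0)
      (fun t ht => (hu t ht).continuousAt.continuousWithinAt)
      (fun t ht => (hu t (interior_subset ht)).hasDerivWithinAt) fun t ht => ?_
    have ht0 : 0 < t := interior_subset ht
    have h1 : 0 ≤ ψ' t ^ 2 * t := by positivity
    have h2 : 0 ≤ ψ t ^ 2 * t := by positivity
    nlinarith
  have hu_nonpos : ∀ t ∈ Ioi (0 : ℝ), ψ t * v t ≤ 0 := by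
    intro t₀ ht₀
    by_contra! hpos
    have hbound : IntegrableOn (fun _ : ℝ => ψ t₀ * v t₀) (Ioi t₀) := by
      refine Integrable.mono' ((hint1.add hint2).mono_set (Ioi_subset_Ioi (le_of_lt ht₀)))
        aestronglyMeasurable_const
        ((ae_restrict_iff' measurableSet_Ioi).2 (.of_forall fun t ht => ?_))
      have ht0 : (0 : ℝ) < t := lt_trans ht₀ ht
      have hle : ψ t₀ * v t₀ ≤ ψ t * v t := hu_mono ht₀ ht0 (le_of_lt ht)
      have hsq : 0 ≤ (ψ t - ψ' t) ^ 2 * t := by positivity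
      have hsq' : 0 ≤ (ψ t ^ 2 + ψ' t ^ 2) * t := by positivity
      rw [Real.norm_of_nonneg hpos.le]
      simp only [hvdef, Pi.add_apply] at hle ⊢
      nlinarith
    rw [integrableOn_const_iff, enorm_eq_zero, Real.volume_Ioi] at hbound
    exact hbound.elim hpos.ne' (lt_irrefl _)
  have hv2_anti : AntitoneOn (fun t => v t ^ 2) (Ioi 0) := by
    refine antitoneOn_of_hasDerivWithinAt_nonpos (convex_Ioi 0)
      (fun t ht => ((hv t ht).pow 2).continuousAt.continuousWithinAt)
      (fun t ht => ((hv t (interior_subset ht)).pow 2).hasDerivWithinAt) fun t ht => ?_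
    have ht0 : 0 < t := interior_subset ht
    have h1 : 0 ≤ -lam * t * -(ψ t * v t) :=
      mul_nonneg (mul_nonneg (by linarith) ht0.le) (by linarith [hu_nonpos t ht0])
    norm_num
    nlinarith
  have hv0 : ∀ t ∈ Ioi (0 : ℝ), v t = 0 := by
    intro t₁ ht₁
    by_contra hne
    have hpos : 0 < v t₁ ^ 2 := by positivity
    have hbound : IntegrableOn (fun t : ℝ => t⁻¹) (Ioc 0 t₁) := by
      refine Integrable.mono' ((hint2.mono_set Ioc_subset_Ioi_self).const_mul (v t₁ ^ 2)⁻¹)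
        measurable_inv.aestronglyMeasurable
        ((ae_restrict_iff' measurableSet_Ioc).2 (.of_forall fun t ht => ?_))
      have ht0 : 0 < t := ht.1
      have hle : v t₁ ^ 2 ≤ v t ^ 2 := hv2_anti ht0 ht₁ ht.2
      have hvt : ψ' t ^ 2 * t = v t ^ 2 * t⁻¹ := by
        simp only [hvdef]
        field_simp
      rw [Real.norm_of_nonneg (by positivity), hvt, ← mul_assoc]
      refine le_mul_of_one_le_left (by positivity) ?_
      rwa [inv_mul_eq_div, one_le_div hpos]
    rw [← intervalIntegrable_iff_integrableOn_Ioc_of_le (le_of_lt ht₁),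
      intervalIntegrable_inv_iff] at hbound
    rcases hbound with h | h
    · exact (ne_of_lt ht₁) h
    · exact h left_mem_uIcc
  have hψ' : ∀ t ∈ Ioi (0 : ℝ), ψ' t = 0 := fun t ht =>
    (mul_eq_zero.1 (hv0 t ht)).resolve_right (ne_of_gt ht)
  have hψ : ∀ t ∈ Ioi (0 : ℝ), ψ t = 0 := by
    intro t ht
    have hzero : HasDerivAt v 0 t := (hasDerivAt_const t (0 : ℝ)).congr_of_eventuallyEq <| by
      filter_upwards [Ioi_mem_nhds ht] with x hx using hv0 x hx
    have h := (hv t ht).unique hzero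
    have ht0 : t ≠ 0 := ne_of_gt ht
    simpa [hlam.ne, ht0] using h
  refine ⟨?_, hψ⟩
  rw [setIntegral_eq_zero_of_forall_eq_zero fun t ht => by simp [hψ' t ht],
    setIntegral_eq_zero_of_forall_eq_zero fun t ht => by simp [hψ t ht], mul_zero]

end
end
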